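/- The induced group homomorphism W -> GL(V) is injective with image a reflection group on V if and only if G is of complete intersection and W acts trivially on I/(A_+ I), i.e. if and only if G is a good normal subgroup of W~. -/

import Mathlib

open MvPolynomial

noncomputable section

namespace ReflQuot

variable {k : Type} [Field k]

/-- The action of an invertible matrix `g` on polynomial functions on `k^n`:
the linear form `X i` is sent to `∑ j, (g⁻¹) i j • X j`, so that
`(g • f) (v) = f (g⁻¹ ⬝ v)`. -/
def matAct {n : ℕ} (g : Matrix.GeneralLinearGroup (Fin n) k) :
    MvPolynomial (Fin n) k →ₐ[k] MvPolynomial (Fin n) k :=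
  aeval fun i => ∑ j, ((↑(g⁻¹) : Matrix (Fin n) (Fin n) k) i j) • X j

/-- The algebra endomorphism of `k[X_1,…,X_m]` sending `X i` to `∑ j, M i j • X j`. -/
def polyAct {m : ℕ} (M : Fin m → Fin m → k) :
    MvPolynomial (Fin m) k →ₐ[k] MvPolynomial (Fin m) k :=
  aeval fun i => ∑ j, M i j • X j

/-- A reflection: an automorphism of finite order whose fixed-point subspace is a
hyperplane. -/
def IsReflection {n : ℕ} (M : Matrix (Fin n) (Fin n) k) : Prop :=
  IsOfFinOrder M ∧
    Module.finrank k (LinearMap.ker (Matrix.toLin' M - LinearMap.id)) + 1 = n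

/-- A double reflection: finite order, fixed points of codimension 2. -/
def IsDoubleReflection {n : ℕ} (M : Matrix (Fin n) (Fin n) k) : Prop :=
  IsOfFinOrder M ∧
    Module.finrank k (LinearMap.ker (Matrix.toLin' M - LinearMap.id)) + 2 = n

/-- A reflection group: a group generated by its reflections. -/
def IsReflectionGroup {n : ℕ} (W : Subgroup (Matrix.GeneralLinearGroup (Fin n) k)) : Prop :=
  Subgroup.closure {g | g ∈ W ∧ IsReflection ((g : Matrix (Fin n) (Fin n) k))} = W

/-- The algebra of `G`-invariant polynomials. -/
def invariants {n : ℕ} (G : Subgroup (Matrix.GeneralLinearGroup (Fin n) k)) :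
    Subalgebra k (MvPolynomial (Fin n) k) where
  carrier := {f | ∀ g ∈ G, matAct g f = f}
  mul_mem' := fun {a b} ha hb g hg => by
    rw [map_mul, ha g hg, hb g hg]
  one_mem' := fun g _ => map_one (matAct g)
  add_mem' := fun {a b} ha hb g hg => by
    rw [map_add, ha g hg, hb g hg]
  zero_mem' := fun g _ => map_zero (matAct g)
  algebraMap_mem' := fun r g _ => (matAct g).commutes r

/-- The linear span of products of two positive-degree invariants, i.e. `(B^G_+)^2`. -/
def sqSpan {n : ℕ} (G : Subgroup (Matrix.GeneralLinearGroup (Fin n) k)) :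
    Submodule k (MvPolynomial (Fin n) k) :=
  Submodule.span k {f | ∃ u ∈ invariants G, ∃ v ∈ invariants G,
    constantCoeff u = 0 ∧ constantCoeff v = 0 ∧ f = u * v}

/-- The ideal of positive-degree elements of the polynomial ring. -/
def idealPlus (k : Type) [Field k] (m : ℕ) : Ideal (MvPolynomial (Fin m) k) :=
  Ideal.span (Set.range X)

/-- The ideal `I` of relations between the generators `p i` of the invariant algebra:
the kernel of `k[V] = k[X_1,…,X_m] → B^G`, `X i ↦ p i`. -/
def relIdeal {n m : ℕ} (p : Fin m → MvPolynomial (Fin n) k) :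
    Ideal (MvPolynomial (Fin m) k) :=
  RingHom.ker (aeval p : MvPolynomial (Fin m) k →ₐ[k] MvPolynomial (Fin n) k)

/-- The context: `Wt` is a finite reflection group on `k^n`, `G` a normal subgroup of `Wt`,
`p` a minimal system of homogeneous generators (of degrees `d`) of the invariant algebra
`B^G` whose span is `Wt`-stable (i.e. a graded `W`-equivariant section of
`B^G_+ → B^G_+/(B^G_+)^2`), and `c w` the matrix of the action of `w` on the span of the
`p i`, giving the induced action of `W = Wt/G` on `V = k^m`. -/
structure QuotSetup {n m : ℕ} (Wt G : Subgroup (Matrix.GeneralLinearGroup (Fin n) k))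
    (p : Fin m → MvPolynomial (Fin n) k) (d : Fin m → ℕ)
    (c : ↥Wt → Fin m → Fin m → k) : Prop where
  finite : (Wt : Set (Matrix.GeneralLinearGroup (Fin n) k)).Finite
  reflGroup : IsReflectionGroup Wt
  le : G ≤ Wt
  normal : ∀ w ∈ Wt, ∀ g ∈ G, w * g * w⁻¹ ∈ G
  homog : ∀ i, (p i).IsHomogeneous (d i)
  dpos : ∀ i, 0 < d i
  gen : Algebra.adjoin k (Set.range p) = invariants G
  minimal : ∀ a : Fin m → k, (∑ i, a i • p i) ∈ sqSpan G → a = 0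
  equivar : ∀ (w : ↥Wt) (i), matAct (w : Matrix.GeneralLinearGroup (Fin n) k) (p i)
      = ∑ j, c w i j • p j

/-- `W = Wt/G` acts trivially on the conormal module `I/(A_+ I)`. -/
def TrivialConormal {n m : ℕ} (Wt : Subgroup (Matrix.GeneralLinearGroup (Fin n) k))
    (p : Fin m → MvPolynomial (Fin n) k) (c : ↥Wt → Fin m → Fin m → k) : Prop :=
  ∀ w : ↥Wt, ∀ f ∈ relIdeal p, polyAct (c w) f - f ∈ idealPlus k m * relIdeal p

/-- `G` is of complete intersection: `I` is generated by `dim V - dim Vt = m - n` elements. -/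
def IsCompleteIntersection {n m : ℕ} (p : Fin m → MvPolynomial (Fin n) k) : Prop :=
  ∃ s : Finset (MvPolynomial (Fin m) k), s.card = m - n ∧ Ideal.span (s : Set _) = relIdeal p

/-- `G` is a good normal subgroup of `Wt`. -/
def IsGoodQuot {n m : ℕ} (Wt : Subgroup (Matrix.GeneralLinearGroup (Fin n) k))
    (p : Fin m → MvPolynomial (Fin n) k) (c : ↥Wt → Fin m → Fin m → k) : Prop :=
  IsCompleteIntersection p ∧ TrivialConormal Wt p c


/-- The pointwise stabilizer of a subspace `L` in `GL_n(k)`. -/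
def pointStab {n : ℕ} (L : Submodule k (Fin n → k)) :
    Subgroup (Matrix.GeneralLinearGroup (Fin n) k) where
  carrier := {g | ∀ x ∈ L, Matrix.mulVec (g : Matrix (Fin n) (Fin n) k) x = x}
  one_mem' := fun x _ => Matrix.one_mulVec x
  mul_mem' := fun {a b} ha hb x hx => by
    rw [Units.val_mul, ← Matrix.mulVec_mulVec, hb x hx, ha x hx]
  inv_mem' := fun {a} ha x hx => by
    have h1 : Matrix.mulVec (↑(a⁻¹) : Matrix (Fin n) (Fin n) k)
        (Matrix.mulVec (↑a : Matrix (Fin n) (Fin n) k) x) = x := by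
      rw [Matrix.mulVec_mulVec, ← Units.val_mul, inv_mul_cancel, Units.val_one,
        Matrix.one_mulVec]
    rw [ha x hx] at h1
    exact h1

/-- The set of reflecting hyperplanes of a subgroup `W` of `GL_n(k)`. -/
def reflHyps {n : ℕ} (W : Subgroup (Matrix.GeneralLinearGroup (Fin n) k)) :
    Set (Submodule k (Fin n → k)) :=
  {H | ∃ g ∈ W, IsReflection ((g : Matrix (Fin n) (Fin n) k)) ∧
      H = LinearMap.ker (Matrix.toLin' ((g : Matrix (Fin n) (Fin n) k)) - LinearMap.id)}

/-- The set `A'(Wt)` of reflecting hyperplanes `H` of `Wt` such that `Wt_H ≠ G_H`. -/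
def reflHyps' {n : ℕ} (Wt G : Subgroup (Matrix.GeneralLinearGroup (Fin n) k)) :
    Set (Submodule k (Fin n → k)) :=
  {H | H ∈ reflHyps Wt ∧ ¬ (Wt ⊓ pointStab H ≤ G)}

/-- `Wt_H` and `Wt_{H'}` have the same image in `W = Wt/G`. -/
def imageEq {n : ℕ} (Wt G : Subgroup (Matrix.GeneralLinearGroup (Fin n) k))
    (H H' : Submodule k (Fin n → k)) : Prop :=
  {x | ∃ g ∈ G, ∃ u ∈ Wt ⊓ pointStab H, x = g * u}
    = {x | ∃ g ∈ G, ∃ u ∈ Wt ⊓ pointStab H', x = g * u}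

/-- `e_H = |G_H|`. -/
def eH {n : ℕ} (G : Subgroup (Matrix.GeneralLinearGroup (Fin n) k))
    (H : Submodule k (Fin n → k)) : ℕ :=
  Nat.card ↥(G ⊓ pointStab H)

/-- The map `p : Vt → V`, `x ↦ (p 1 (x), …, p m (x))`. -/
def pMap {n m : ℕ} (p : Fin m → MvPolynomial (Fin n) k) (x : Fin n → k) : Fin m → k :=
  fun i => eval x (p i)

/-- The matrix of the action of (the image in `W` of) `w` on `V = k^m`. -/
def qMat {n m : ℕ} {Wt : Subgroup (Matrix.GeneralLinearGroup (Fin n) k)}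
    (c : ↥Wt → Fin m → Fin m → k) (w : ↥Wt) : Matrix (Fin m) (Fin m) k :=
  Matrix.of (c w⁻¹)

/-- The set of reflecting hyperplanes of `W = Wt/G` acting on `V = k^m`. -/
def reflHypsV {n m : ℕ} {Wt : Subgroup (Matrix.GeneralLinearGroup (Fin n) k)}
    (c : ↥Wt → Fin m → Fin m → k) : Set (Submodule k (Fin m → k)) :=
  {K | ∃ w : ↥Wt, IsReflection (qMat c w) ∧
      K = LinearMap.ker (Matrix.toLin' (qMat c w) - LinearMap.id)}

/-- The underlying matrix of an element of a subgroup of `GL_n(k)`. -/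
def matOf {n : ℕ} {Wt : Subgroup (Matrix.GeneralLinearGroup (Fin n) k)} (w : ↥Wt) :
    Matrix (Fin n) (Fin n) k :=
  ((w : Matrix.GeneralLinearGroup (Fin n) k) : Matrix (Fin n) (Fin n) k)

section Action

variable {n : ℕ}

lemma matAct_X (g : Matrix.GeneralLinearGroup (Fin n) k) (i : Fin n) :
    matAct g (X i) = ∑ j, ((↑(g⁻¹) : Matrix (Fin n) (Fin n) k) i j) • X j := by
  simp [matAct]

lemma matAct_one (f : MvPolynomial (Fin n) k) : matAct 1 f = f := by
  have : matAct (1 : Matrix.GeneralLinearGroup (Fin n) k) = AlgHom.id k _ := by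
    ext1 i
    simp [matAct_X, Matrix.one_apply]
  rw [this, AlgHom.id_apply]

lemma matAct_mul (g h : Matrix.GeneralLinearGroup (Fin n) k) (f : MvPolynomial (Fin n) k) :
    matAct (g * h) f = matAct g (matAct h f) := by
  have : matAct (g * h) = (matAct g).comp (matAct h) := by
    ext1 i
    simp only [AlgHom.comp_apply, matAct_X, map_sum, map_smul, mul_inv_rev, Units.val_mul,
      Matrix.mul_apply, Finset.sum_smul, Finset.smul_sum, smul_smul]
    rw [Finset.sum_comm]
  rw [this, AlgHom.comp_apply]

lemma matAct_inv_matAct (g : Matrix.GeneralLinearGroup (Fin n) k) (f : MvPolynomial (Fin n) k) :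
    matAct g⁻¹ (matAct g f) = f := by
  rw [← matAct_mul, inv_mul_cancel, matAct_one]

lemma matAct_matAct_inv (g : Matrix.GeneralLinearGroup (Fin n) k) (f : MvPolynomial (Fin n) k) :
    matAct g (matAct g⁻¹ f) = f := by
  rw [← matAct_mul, mul_inv_cancel, matAct_one]

lemma matAct_injective (g : Matrix.GeneralLinearGroup (Fin n) k) :
    Function.Injective (matAct g) :=
  Function.LeftInverse.injective (matAct_inv_matAct g)

lemma eq_of_matAct_X_eq {g h : Matrix.GeneralLinearGroup (Fin n) k}
    (H : ∀ i, matAct g (X i) = matAct h (X i)) : g = h := by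
  rw [← inv_inj]
  ext i j
  have := congrArg (coeff (Finsupp.single j 1)) (H i)
  simpa [matAct_X, coeff_sum, coeff_smul, coeff_X, Finsupp.single_left_inj,
    Finset.sum_ite_eq] using this

lemma matAct_isHomogeneous (g : Matrix.GeneralLinearGroup (Fin n) k)
    {f : MvPolynomial (Fin n) k} {e : ℕ} (hf : f.IsHomogeneous e) :
    (matAct g f).IsHomogeneous e := by
  have := hf.aeval (fun i => ∑ j, ((↑(g⁻¹) : Matrix (Fin n) (Fin n) k) i j) •
    (X j : MvPolynomial (Fin n) k)) (n := 1) (fun i => ?_)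
  · simpa [matAct] using this
  · refine IsHomogeneous.sum _ _ _ fun j _ => ?_
    rw [smul_eq_C_mul]
    exact (isHomogeneous_X k j).C_mul _

lemma constantCoeff_matAct (g : Matrix.GeneralLinearGroup (Fin n) k)
    (f : MvPolynomial (Fin n) k) : constantCoeff (matAct g f) = constantCoeff f := by
  induction f using MvPolynomial.induction_on with
  | C a => simp [matAct]
  | add p q hp hq => simp [hp, hq]
  | mul_X p i hp => simp [matAct_X, smul_eq_C_mul]

lemma totalDegree_matAct_le (g : Matrix.GeneralLinearGroup (Fin n) k)
    (f : MvPolynomial (Fin n) k) : (matAct g f).totalDegree ≤ f.totalDegree := by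
  conv_lhs => rw [← f.sum_homogeneousComponent]
  rw [map_sum]
  refine totalDegree_finsetSum_le fun i hi => ?_
  refine (matAct_isHomogeneous g (homogeneousComponent_isHomogeneous i f)).totalDegree_le.trans ?_
  simp at hi; omega

end Action

section Grading

variable {σ τ : Type} {d : σ → ℕ}

lemma mem_of_weightedHomogeneousComponent_mem {K : Submodule k (MvPolynomial σ k)}
    {x : MvPolynomial σ k} (h : ∀ e, weightedHomogeneousComponent d e x ∈ K) : x ∈ K := by
  rw [← finsum_weightedHomogeneousComponent d x]
  exact finsum_induction (· ∈ K) K.zero_mem (fun _ _ => K.add_mem) h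

lemma weightedHomogeneousComponent_mem_span {E : Set (MvPolynomial σ k)}
    (hE : ∀ x ∈ E, ∃ e, IsWeightedHomogeneous d x e) {x : MvPolynomial σ k}
    (hx : x ∈ Submodule.span k E) (e : ℕ) :
    weightedHomogeneousComponent d e x ∈
      Submodule.span k {y ∈ E | IsWeightedHomogeneous d y e} := by
  induction hx using Submodule.span_induction with
  | mem x hx =>
    obtain ⟨e', he'⟩ := hE x hx
    by_cases h : e' = e
    · subst h
      rw [he'.weightedHomogeneousComponent_same]
      exact Submodule.subset_span ⟨hx, he'⟩
    · rw [he'.weightedHomogeneousComponent_ne e (Ne.symm h)]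
      exact Submodule.zero_mem _
  | zero => simp
  | add x y _ _ hx hy => rw [map_add]; exact Submodule.add_mem _ hx hy
  | smul a x _ hx => rw [map_smul]; exact Submodule.smul_mem _ _ hx

lemma weightedHomogeneousComponent_mem_of_span {E : Set (MvPolynomial σ k)}
    (hE : ∀ x ∈ E, ∃ e, IsWeightedHomogeneous d x e) {x : MvPolynomial σ k}
    (hx : x ∈ Submodule.span k E) (e : ℕ) :
    weightedHomogeneousComponent d e x ∈ Submodule.span k E :=
  Submodule.span_mono (Set.sep_subset _ _) (weightedHomogeneousComponent_mem_span hE hx e)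

lemma isWeightedHomogeneous_aeval {d' : τ → ℕ} {g : σ → MvPolynomial τ k}
    (hg : ∀ i, IsWeightedHomogeneous d' (g i) (d i)) {f : MvPolynomial σ k} {e : ℕ}
    (hf : IsWeightedHomogeneous d f e) : IsWeightedHomogeneous d' (aeval g f) e := by
  rw [aeval_def, eval₂_eq]
  refine IsWeightedHomogeneous.sum _ _ _ fun m hm => ?_
  rw [algebraMap_eq]
  refine IsWeightedHomogeneous.C_mul ?_ _
  rw [← hf (mem_support_iff.mp hm), Finsupp.weight_apply, Finsupp.sum]
  exact IsWeightedHomogeneous.prod _ _ _ fun i _ => by simpa using (hg i).pow (m i)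

lemma weightedHomogeneousComponent_algHom {d' : τ → ℕ}
    (φ : MvPolynomial σ k →ₐ[k] MvPolynomial τ k)
    (hφ : ∀ f e, IsWeightedHomogeneous d f e → IsWeightedHomogeneous d' (φ f) e)
    (e : ℕ) (f : MvPolynomial σ k) :
    weightedHomogeneousComponent d' e (φ f) = φ (weightedHomogeneousComponent d e f) := by
  have : (weightedHomogeneousComponent d' e).comp φ.toLinearMap
      = φ.toLinearMap.comp (weightedHomogeneousComponent d e) := by
    refine MvPolynomial.linearMap_ext fun m => LinearMap.ext_ring ?_
    have hm := isWeightedHomogeneous_monomial d m (1 : k) rfl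
    simp only [LinearMap.comp_apply, AlgHom.toLinearMap_apply]
    by_cases h : Finsupp.weight d m = e
    · rw [h] at hm
      rw [hm.weightedHomogeneousComponent_same, (hφ _ _ hm).weightedHomogeneousComponent_same]
    · rw [hm.weightedHomogeneousComponent_ne e (Ne.symm h),
        (hφ _ _ hm).weightedHomogeneousComponent_ne e (Ne.symm h), map_zero]
  exact LinearMap.congr_fun this f

lemma constantCoeff_eq_zero_of_isWeightedHomogeneous {f : MvPolynomial σ k} {e : ℕ}
    (hf : IsWeightedHomogeneous d f e) (he : 0 < e) : constantCoeff f = 0 := by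
  refine hf.coeff_eq_zero 0 ?_
  simpa using he.ne

lemma weightedHomogeneousComponent_zero_eq [Finite σ] (hd : ∀ i, 0 < d i)
    (f : MvPolynomial σ k) :
    weightedHomogeneousComponent d 0 f = C (constantCoeff f) := by
  rw [constantCoeff_eq]
  exact weightedHomogeneousComponent_zero f fun i => (hd i).ne'

lemma mem_of_sub_mem_pow {m : ℕ} {K : Submodule k (MvPolynomial (Fin m) k)}
    (hK : ∀ z ∈ K, ∀ e, homogeneousComponent e z ∈ K) {x : MvPolynomial (Fin m) k}
    (h : ∀ N, ∃ z ∈ K, x - z ∈ idealPlus k m ^ N) : x ∈ K := by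
  refine mem_of_weightedHomogeneousComponent_mem (d := 1) fun e => ?_
  obtain ⟨z, hz, hxz⟩ := h (e + 1)
  have : homogeneousComponent e (x - z) = 0 := by
    refine homogeneousComponent_eq_zero' _ _ fun a ha => ?_
    have := (mem_pow_idealOfVars_iff _ _).mp hxz a ha
    omega
  rw [map_sub, sub_eq_zero] at this
  change homogeneousComponent e x ∈ K
  rw [this]
  exact hK z hz e

lemma mem_idealPlus_iff {m : ℕ} {f : MvPolynomial (Fin m) k} :
    f ∈ idealPlus k m ↔ constantCoeff f = 0 := by
  have := mem_pow_idealOfVars_iff' 1 f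
  rw [pow_one] at this
  refine this.trans ⟨fun h => h 0 (by simp), fun h x hx => ?_⟩
  have : x = 0 := by simpa [Finsupp.degree_eq_zero_iff] using hx
  subst this
  exact h

end Grading

section Reynolds

variable {n : ℕ} (Γ : Subgroup (Matrix.GeneralLinearGroup (Fin n) k))

lemma mem_invariants {f : MvPolynomial (Fin n) k} :
    f ∈ invariants Γ ↔ ∀ g ∈ Γ, matAct g f = f := Iff.rfl

/-- The Reynolds operator, averaging over a finite linear group. -/
def reynolds [Fintype Γ] : MvPolynomial (Fin n) k →ₗ[k] MvPolynomial (Fin n) k :=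
  (Fintype.card Γ : k)⁻¹ • ∑ g : Γ, (matAct (g : Matrix.GeneralLinearGroup (Fin n) k)).toLinearMap

variable [Fintype Γ]

lemma reynolds_apply (f : MvPolynomial (Fin n) k) :
    reynolds Γ f = (Fintype.card Γ : k)⁻¹ •
      ∑ g : Γ, matAct (g : Matrix.GeneralLinearGroup (Fin n) k) f := by
  simp [reynolds]

lemma reynolds_mem (f : MvPolynomial (Fin n) k) : reynolds Γ f ∈ invariants Γ := by
  intro h hh
  rw [reynolds_apply, map_smul, map_sum]
  congr 1
  refine Fintype.sum_equiv (Equiv.mulLeft ⟨h, hh⟩) _ _ fun g => ?_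
  simp [matAct_mul]

lemma reynolds_mul_right (f : MvPolynomial (Fin n) k) {s : MvPolynomial (Fin n) k}
    (hs : s ∈ invariants Γ) : reynolds Γ (f * s) = reynolds Γ f * s := by
  simp only [reynolds_apply, map_mul, smul_mul_assoc, Finset.sum_mul]
  congr 1
  exact Finset.sum_congr rfl fun g _ => by rw [hs g g.2]

variable [CharZero k]

lemma reynolds_const_sum (f : MvPolynomial (Fin n) k) :
    (Fintype.card Γ : k)⁻¹ • ∑ _g : Γ, f = f := by
  have : (Fintype.card Γ : k) ≠ 0 := Nat.cast_ne_zero.mpr Fintype.card_ne_zero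
  rw [Finset.sum_const, Finset.card_univ, ← Nat.cast_smul_eq_nsmul k, smul_smul,
    inv_mul_cancel₀ this, one_smul]

lemma reynolds_eq_self {f : MvPolynomial (Fin n) k} (hf : f ∈ invariants Γ) :
    reynolds Γ f = f := by
  rw [reynolds_apply, Finset.sum_congr rfl fun (g : Γ) _ => hf g g.2, reynolds_const_sum]

lemma constantCoeff_reynolds (f : MvPolynomial (Fin n) k) :
    constantCoeff (reynolds Γ f) = constantCoeff f := by
  have : (Fintype.card Γ : k) ≠ 0 := Nat.cast_ne_zero.mpr Fintype.card_ne_zero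
  simp [reynolds_apply, constantCoeff_matAct, smul_eq_C_mul, this]

/-- An element lies in a subspace modulo which it is fixed by the group, after averaging. -/
lemma sub_reynolds_mem {K : Submodule k (MvPolynomial (Fin n) k)} {f : MvPolynomial (Fin n) k}
    (h : ∀ g ∈ Γ, matAct g f - f ∈ K) : f - reynolds Γ f ∈ K := by
  have : f - reynolds Γ f = -((Fintype.card Γ : k)⁻¹ •
      ∑ g : Γ, (matAct (g : Matrix.GeneralLinearGroup (Fin n) k) f - f)) := by
    rw [Finset.sum_sub_distrib, smul_sub, reynolds_const_sum, reynolds_apply, neg_sub]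
  rw [this]
  exact K.neg_mem (K.smul_mem _ (K.sum_mem fun g _ => h g g.2))

end Reynolds

section Generators

open scoped Pointwise

variable {n : ℕ} {Γ : Subgroup (Matrix.GeneralLinearGroup (Fin n) k)} {d : Fin n → ℕ}

/-- The group preserves the grading given by the weights `d`. -/
def PreservesWeights (Γ : Subgroup (Matrix.GeneralLinearGroup (Fin n) k)) (d : Fin n → ℕ) : Prop :=
  ∀ g ∈ Γ, ∀ f e, IsWeightedHomogeneous d f e → IsWeightedHomogeneous d (matAct g f) e

lemma preservesWeights_one (Γ : Subgroup (Matrix.GeneralLinearGroup (Fin n) k)) :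
    PreservesWeights Γ 1 :=
  fun g _ _ _ hf => matAct_isHomogeneous g hf

variable (Γ) in
/-- The space of invariants of positive degree. -/
def posInvariants : Submodule k (MvPolynomial (Fin n) k) where
  carrier := {f | f ∈ invariants Γ ∧ constantCoeff f = 0}
  add_mem' := fun ha hb => ⟨add_mem ha.1 hb.1, by rw [map_add, ha.2, hb.2, add_zero]⟩
  zero_mem' := ⟨zero_mem _, map_zero _⟩
  smul_mem' := fun a _ hf => ⟨Subalgebra.smul_mem _ hf.1 a, by simp [smul_eq_C_mul, hf.2]⟩

variable (Γ d) in
/-- The weighted homogeneous invariants of positive degree. -/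
def homogInvariants : Set (MvPolynomial (Fin n) k) :=
  {f | f ∈ invariants Γ ∧ ∃ e, 0 < e ∧ IsWeightedHomogeneous d f e}

lemma sqSpan_eq_mul : sqSpan Γ = posInvariants Γ * posInvariants Γ := by
  apply le_antisymm
  · refine Submodule.span_le.mpr ?_
    rintro f ⟨u, hu, v, hv, hu0, hv0, rfl⟩
    exact Submodule.mul_mem_mul ⟨hu, hu0⟩ ⟨hv, hv0⟩
  · refine Submodule.mul_le.mpr fun u hu v hv => Submodule.subset_span ?_
    exact ⟨u, hu.1, v, hv.1, hu.2, hv.2, rfl⟩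

lemma mul_mem_sqSpan {u v : MvPolynomial (Fin n) k} (hu : u ∈ posInvariants Γ)
    (hv : v ∈ posInvariants Γ) : u * v ∈ sqSpan Γ := by
  rw [sqSpan_eq_mul]
  exact Submodule.mul_mem_mul hu hv

lemma weightedHomogeneousComponent_mem_invariants (hΓ : PreservesWeights Γ d)
    {f : MvPolynomial (Fin n) k} (hf : f ∈ invariants Γ) (e : ℕ) :
    weightedHomogeneousComponent d e f ∈ invariants Γ := fun g hg => by
  rw [← weightedHomogeneousComponent_algHom _ (hΓ g hg), hf g hg]

lemma homogInvariants_subset : homogInvariants Γ d ⊆ posInvariants Γ :=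
  fun _ ⟨hf, _, he, hfe⟩ => ⟨hf, constantCoeff_eq_zero_of_isWeightedHomogeneous hfe he⟩

lemma posInvariants_eq_span (hΓ : PreservesWeights Γ d) (hd : ∀ i, 0 < d i) :
    posInvariants Γ = Submodule.span k (homogInvariants Γ d) := by
  apply le_antisymm
  · intro f hf
    refine mem_of_weightedHomogeneousComponent_mem (d := d) fun e => ?_
    rcases Nat.eq_zero_or_pos e with rfl | he
    · rw [weightedHomogeneousComponent_zero_eq hd, hf.2, map_zero]
      exact zero_mem _
    · exact Submodule.subset_span ⟨weightedHomogeneousComponent_mem_invariants hΓ hf.1 e, e, he,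
        weightedHomogeneousComponent_isWeightedHomogeneous e f⟩
  · exact Submodule.span_le.mpr homogInvariants_subset

lemma sqSpan_eq_span (hΓ : PreservesWeights Γ d) (hd : ∀ i, 0 < d i) :
    sqSpan Γ = Submodule.span k (homogInvariants Γ d * homogInvariants Γ d) := by
  rw [sqSpan_eq_mul, posInvariants_eq_span hΓ hd, Submodule.span_mul_span]

lemma exists_degree_of_mem_mul {x : MvPolynomial (Fin n) k}
    (hx : x ∈ homogInvariants Γ d * homogInvariants Γ d) :
    ∃ e, IsWeightedHomogeneous d x e := by
  obtain ⟨u, ⟨_, a, _, ha⟩, v, ⟨_, b, _, hb⟩, rfl⟩ := hx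
  exact ⟨a + b, ha.mul hb⟩

/-- The square of the augmentation ideal of the invariants is closed in the adic topology. -/
lemma mem_sqSpan_of_sub_mem_pow {x : MvPolynomial (Fin n) k}
    (h : ∀ N, ∃ z ∈ sqSpan Γ, x - z ∈ idealPlus k n ^ N) : x ∈ sqSpan Γ := by
  refine mem_of_sub_mem_pow (fun z hz e => ?_) h
  rw [sqSpan_eq_span (preservesWeights_one Γ) (fun _ => one_pos)] at hz ⊢
  exact weightedHomogeneousComponent_mem_of_span (fun x => exists_degree_of_mem_mul) hz e

/-- Homogeneous elements spanning the cotangent space generate the invariant algebra. -/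
lemma adjoin_eq_invariants {ι : Type} (hΓ : PreservesWeights Γ d) (hd : ∀ i, 0 < d i)
    {f : ι → MvPolynomial (Fin n) k} (hf : ∀ i, f i ∈ homogInvariants Γ d)
    (hspan : posInvariants Γ ≤ Submodule.span k (Set.range f) ⊔ sqSpan Γ) :
    Algebra.adjoin k (Set.range f) = invariants Γ := by
  apply le_antisymm
  · exact Algebra.adjoin_le (by rintro _ ⟨i, rfl⟩; exact (hf i).1)
  have key : ∀ e x, x ∈ invariants Γ → IsWeightedHomogeneous d x e →
      x ∈ Algebra.adjoin k (Set.range f) := by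
    intro e
    induction e using Nat.strong_induction_on with
    | _ e ih =>
      intro x hx hxe
      rcases Nat.eq_zero_or_pos e with rfl | he
      · rw [← hxe.weightedHomogeneousComponent_same, weightedHomogeneousComponent_zero_eq hd]
        exact Subalgebra.algebraMap_mem _ _
      have hx' := hspan (homogInvariants_subset ⟨hx, e, he, hxe⟩)
      rw [sqSpan_eq_span hΓ hd, ← Submodule.span_union] at hx'
      have h2 := weightedHomogeneousComponent_mem_span (d := d) ?_ hx' e
      · rw [hxe.weightedHomogeneousComponent_same] at h2
        change x ∈ Subalgebra.toSubmodule (Algebra.adjoin k (Set.range f))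
        refine Submodule.span_le.mpr ?_ h2
        rintro y ⟨⟨i, rfl⟩ | ⟨u, ⟨hu, a, ha, hua⟩, v, ⟨hv, b, hb, hvb⟩, rfl⟩, hy⟩
        · exact Algebra.subset_adjoin ⟨i, rfl⟩
        · dsimp only at hy ⊢
          by_cases h0 : u * v = 0
          · rw [h0]; exact zero_mem _
          have hab : a + b = e := (hua.mul hvb).inj_right h0 hy
          exact Subalgebra.mul_mem _ (ih a (by omega) u hu hua) (ih b (by omega) v hv hvb)
      · rintro y (⟨i, rfl⟩ | hy)
        · obtain ⟨-, e, -, he⟩ := hf i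
          exact ⟨e, he⟩
        · exact exists_degree_of_mem_mul hy
  intro x hx
  exact mem_of_weightedHomogeneousComponent_mem (d := d)
    (K := Subalgebra.toSubmodule (Algebra.adjoin k (Set.range f))) fun e =>
    key e _ (weightedHomogeneousComponent_mem_invariants hΓ hx e)
      (weightedHomogeneousComponent_isWeightedHomogeneous e x)

/-- From a family spanning the cotangent space one can extract a family of representatives
of a basis. -/
lemma exists_subfamily {ι : Type} {f : ι → MvPolynomial (Fin n) k}
    (hspan : posInvariants Γ ≤ Submodule.span k (Set.range f) ⊔ sqSpan Γ) :
    ∃ (κ : Type) (a : κ → ι), Function.Injective a ∧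
      posInvariants Γ ≤ Submodule.span k (Set.range (f ∘ a)) ⊔ sqSpan Γ ∧
      LinearIndependent k ((sqSpan Γ).mkQ ∘ f ∘ a) := by
  obtain ⟨κ, a, ha, hs, hli⟩ := exists_linearIndependent' k ((sqSpan Γ).mkQ ∘ f)
  refine ⟨κ, a, ha, ?_, hli⟩
  have h : ∀ {τ : Type} (g : τ → MvPolynomial (Fin n) k),
      Submodule.span k (Set.range g) ⊔ sqSpan Γ =
      (Submodule.span k (Set.range ((sqSpan Γ).mkQ ∘ g))).comap (sqSpan Γ).mkQ := fun g => by
    rw [Set.range_comp, ← Submodule.map_span, Submodule.comap_map_mkQ, sup_comm]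
  rw [h] at hspan ⊢
  rw [← Function.comp_assoc, hs]
  exact hspan

lemma exists_homogeneous_basis (hΓ : PreservesWeights Γ d) (hd : ∀ i, 0 < d i) :
    ∃ (ι : Type) (f : ι → MvPolynomial (Fin n) k), (∀ i, f i ∈ homogInvariants Γ d) ∧
      posInvariants Γ ≤ Submodule.span k (Set.range f) ⊔ sqSpan Γ ∧
      LinearIndependent k ((sqSpan Γ).mkQ ∘ f) := by
  obtain ⟨κ, a, -, hs, hli⟩ := exists_subfamily (Γ := Γ)
    (f := ((↑) : homogInvariants Γ d → MvPolynomial (Fin n) k)) (by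
      rw [Subtype.range_coe, ← posInvariants_eq_span hΓ hd]
      exact le_sup_left)
  exact ⟨κ, _, fun i => (a i).2, hs, hli⟩

end Generators

section Reflections

variable {n : ℕ}

lemma ker_toLin'_inv_sub_id (g : Matrix.GeneralLinearGroup (Fin n) k) :
    LinearMap.ker (Matrix.toLin' ((g⁻¹ : Matrix.GeneralLinearGroup (Fin n) k) :
      Matrix (Fin n) (Fin n) k) - LinearMap.id) =
    LinearMap.ker (Matrix.toLin' (g : Matrix (Fin n) (Fin n) k) - LinearMap.id) := by
  have key : ∀ (h : Matrix.GeneralLinearGroup (Fin n) k) (x : Fin n → k),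
      (h : Matrix (Fin n) (Fin n) k).mulVec x = x →
      ((h⁻¹ : Matrix.GeneralLinearGroup (Fin n) k) : Matrix (Fin n) (Fin n) k).mulVec x = x := by
    intro h x hx
    conv_lhs => rw [← hx]
    rw [Matrix.mulVec_mulVec, ← Units.val_mul, inv_mul_cancel, Units.val_one, Matrix.one_mulVec]
  ext x
  simp only [LinearMap.mem_ker, LinearMap.sub_apply, Matrix.toLin'_apply, LinearMap.id_apply,
    sub_eq_zero]
  exact ⟨fun h => by simpa using key g⁻¹ x h, key g x⟩

lemma exists_mul_of_isReflection {g : Matrix.GeneralLinearGroup (Fin n) k}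
    (hg : IsReflection (g : Matrix (Fin n) (Fin n) k)) :
    ∃ v c : Fin n → k, ∀ i j,
      ((g⁻¹ : Matrix.GeneralLinearGroup (Fin n) k) : Matrix (Fin n) (Fin n) k) i j
        - (1 : Matrix (Fin n) (Fin n) k) i j = v i * c j := by
  set L := Matrix.toLin' ((g⁻¹ : Matrix.GeneralLinearGroup (Fin n) k) :
      Matrix (Fin n) (Fin n) k) - LinearMap.id with hL
  have h1 : Module.finrank k (LinearMap.range L) = 1 := by
    have h2 : Module.finrank k (LinearMap.ker L) + 1 = n := by
      rw [hL, ker_toLin'_inv_sub_id]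
      exact hg.2
    have := LinearMap.finrank_range_add_finrank_ker L
    simp only [Module.finrank_fintype_fun_eq_card, Fintype.card_fin] at this
    omega
  obtain ⟨v, -, hv⟩ := finrank_eq_one_iff'.mp h1
  choose c hc using fun j => hv ⟨L (Pi.single j 1), LinearMap.mem_range_self _ _⟩
  refine ⟨v, c, fun i j => ?_⟩
  have := congrFun (congrArg Subtype.val (hc j)) i
  simp only [SetLike.val_smul, Pi.smul_apply, smul_eq_mul] at this
  rw [mul_comm, this]
  simp [hL, Matrix.one_apply, Pi.single_apply]

lemma isReflection_of_mul {g : Matrix.GeneralLinearGroup (Fin n) k} (hfin : IsOfFinOrder g)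
    (h1 : g ≠ 1) {v c : Fin n → k} (h : ∀ i j,
      ((g⁻¹ : Matrix.GeneralLinearGroup (Fin n) k) : Matrix (Fin n) (Fin n) k) i j
        - (1 : Matrix (Fin n) (Fin n) k) i j = v i * c j) :
    IsReflection (g : Matrix (Fin n) (Fin n) k) := by
  refine ⟨(Units.coeHom _).isOfFinOrder hfin, ?_⟩
  rw [← ker_toLin'_inv_sub_id]
  set L := Matrix.toLin' ((g⁻¹ : Matrix.GeneralLinearGroup (Fin n) k) :
      Matrix (Fin n) (Fin n) k) - LinearMap.id with hL
  have hLx : ∀ x, L x = (∑ j, c j * x j) • v := fun x => by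
    ext i
    have : L x = ((((g⁻¹ : Matrix.GeneralLinearGroup (Fin n) k) : Matrix (Fin n) (Fin n) k)
      - 1).mulVec x) := by simp [hL, Matrix.sub_mulVec]
    rw [this]
    simp only [Matrix.mulVec, dotProduct, Matrix.sub_apply, h, Pi.smul_apply, smul_eq_mul,
      Finset.sum_mul]
    exact Finset.sum_congr rfl fun j _ => by ring
  have hne : LinearMap.range L ≠ ⊥ := by
    intro hbot
    rw [LinearMap.range_eq_bot, hL, sub_eq_zero] at hbot
    have := Matrix.toLin'.injective (hbot.trans Matrix.toLin'_one.symm)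
    exact h1 (inv_eq_one.mp (Units.ext this))
  have hle : Module.finrank k (LinearMap.range L) ≤ 1 := by
    have : LinearMap.range L ≤ Submodule.span k {v} := by
      rintro _ ⟨x, rfl⟩
      rw [hLx]
      exact Submodule.smul_mem _ _ (Submodule.mem_span_singleton_self v)
    exact (Submodule.finrank_mono this).trans ((finrank_span_le_card _).trans (by simp))
  have hpos := Submodule.one_le_finrank_iff.mpr hne
  have := LinearMap.finrank_range_add_finrank_ker L
  simp only [Module.finrank_fintype_fun_eq_card, Fintype.card_fin] at this
  omega

lemma dvd_sub_matAct {g : Matrix.GeneralLinearGroup (Fin n) k} {l : MvPolynomial (Fin n) k}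
    (h : ∀ i, l ∣ X i - matAct g (X i)) (f : MvPolynomial (Fin n) k) : l ∣ f - matAct g f := by
  induction f using MvPolynomial.induction_on with
  | C a => simp [matAct]
  | add p q hp hq =>
    rw [map_add, add_sub_add_comm]
    exact dvd_add hp hq
  | mul_X p i hp =>
    have : p * X i - matAct g (p * X i)
        = (p - matAct g p) * X i + matAct g p * (X i - matAct g (X i)) := by
      rw [map_mul]; ring
    rw [this]
    exact dvd_add (hp.mul_right _) ((h i).mul_left _)

lemma exists_linear_form_dvd {g : Matrix.GeneralLinearGroup (Fin n) k}
    (hg : IsReflection (g : Matrix (Fin n) (Fin n) k)) :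
    ∃ l : MvPolynomial (Fin n) k, l.IsHomogeneous 1 ∧ ∀ f, l ∣ f - matAct g f := by
  obtain ⟨v, c, h⟩ := exists_mul_of_isReflection hg
  refine ⟨∑ j, c j • X j, ?_, dvd_sub_matAct fun i => ⟨C (-v i), ?_⟩⟩
  · refine IsHomogeneous.sum _ _ _ fun j _ => ?_
    rw [smul_eq_C_mul]
    exact (isHomogeneous_X k j).C_mul _
  · have h1 : (X i : MvPolynomial (Fin n) k) = ∑ j, (1 : Matrix (Fin n) (Fin n) k) i j • X j := by
      simp [Matrix.one_apply]
    rw [matAct_X]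
    nth_rewrite 1 [h1]
    rw [← Finset.sum_sub_distrib, mul_comm, ← smul_eq_C_mul, Finset.smul_sum]
    refine Finset.sum_congr rfl fun j _ => ?_
    rw [← sub_smul, smul_smul, neg_mul, ← h, neg_sub]

end Reflections

section Flatness

variable {n : ℕ} (Γ : Subgroup (Matrix.GeneralLinearGroup (Fin n) k)) {ι : Type} [Fintype ι]

/-- The linear relations among the `a i` with invariant coefficients. -/
def invRelations (a : ι → MvPolynomial (Fin n) k) : Submodule k (ι → MvPolynomial (Fin n) k) where
  carrier := {y | (∀ i, y i ∈ invariants Γ) ∧ ∑ i, a i * y i = 0}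
  add_mem' := fun hx hy => ⟨fun i => add_mem (hx.1 i) (hy.1 i), by
    simp only [Pi.add_apply, mul_add, Finset.sum_add_distrib, hx.2, hy.2, add_zero]⟩
  zero_mem' := ⟨fun _ => zero_mem _, by simp⟩
  smul_mem' := fun c _ hx => ⟨fun i => Subalgebra.smul_mem _ (hx.1 i) c, by
    simp only [Pi.smul_apply, mul_smul_comm, ← Finset.smul_sum, hx.2, smul_zero]⟩

lemma mem_invRelations {a y : ι → MvPolynomial (Fin n) k} :
    y ∈ invRelations Γ a ↔ (∀ i, y i ∈ invariants Γ) ∧ ∑ i, a i * y i = 0 := Iff.rfl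

variable {Γ}

lemma matAct_comp_mem_span_invRelations {a g : ι → MvPolynomial (Fin n) k}
    (hg : g ∈ Submodule.span (MvPolynomial (Fin n) k)
      (invRelations Γ a : Set (ι → MvPolynomial (Fin n) k)))
    {w : Matrix.GeneralLinearGroup (Fin n) k} (hw : w ∈ Γ) :
    (fun i => matAct w (g i)) ∈ Submodule.span (MvPolynomial (Fin n) k)
      (invRelations Γ a : Set (ι → MvPolynomial (Fin n) k)) := by
  generalize hM : Submodule.span (MvPolynomial (Fin n) k)
      (invRelations Γ a : Set (ι → MvPolynomial (Fin n) k)) = M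
  have hsub : ∀ x ∈ invRelations Γ a, x ∈ M := fun x hx => hM ▸ Submodule.subset_span hx
  induction hg using Submodule.span_induction with
  | mem x hx =>
    have this : (fun i => matAct w (x i)) = x := by
      funext i
      have h1 : x i ∈ invariants Γ := ((mem_invRelations Γ).mp hx).1 i
      have h2 : matAct w (x i) = x i := (mem_invariants Γ).mp h1 w hw
      exact h2
    rw [this]
    exact hsub x hx
  | zero =>
    simp only [Pi.zero_apply, map_zero]
    exact M.zero_mem
  | add x y _ _ hx hy =>
    simp only [Pi.add_apply, map_add]
    exact M.add_mem hx hy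
  | smul c x _ hx =>
    simp only [Pi.smul_apply, smul_eq_mul, map_mul]
    exact M.smul_mem (matAct w c) hx

variable [Finite Γ] [CharZero k]

/-- The equational criterion for flatness of the polynomial ring over the invariants of a
reflection group: every relation with invariant coefficients is a combination of relations
between invariants. -/
lemma mem_span_invRelations (hΓ : IsReflectionGroup Γ) {a : ι → MvPolynomial (Fin n) k}
    (ha : ∀ i, a i ∈ invariants Γ) {g : ι → MvPolynomial (Fin n) k}
    (hg : ∑ i, a i * g i = 0) :
    g ∈ Submodule.span (MvPolynomial (Fin n) k) (invRelations Γ a : Set _) := by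
  have := Fintype.ofFinite Γ
  set M := Submodule.span (MvPolynomial (Fin n) k)
    (invRelations Γ a : Set (ι → MvPolynomial (Fin n) k)) with hM
  suffices H : ∀ N, ∀ g : ι → MvPolynomial (Fin n) k, (∀ i, g i = 0 ∨ (g i).totalDegree < N) →
      ∑ i, a i * g i = 0 → g ∈ M from
    H (Finset.univ.sup (fun i => (g i).totalDegree) + 1) g (fun i => Or.inr
      (Nat.lt_succ_of_le (Finset.le_sup (f := fun i => (g i).totalDegree) (Finset.mem_univ i)))) hg
  intro N
  induction N with
  | zero =>
    intro g hdeg _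
    have : g = 0 := funext fun i => (hdeg i).resolve_right (Nat.not_lt_zero _)
    rw [this]
    exact M.zero_mem
  | succ N ih =>
    intro g hdeg hg
    have hrefl : ∀ w ∈ Γ, IsReflection (w : Matrix (Fin n) (Fin n) k) →
        (fun i => g i - matAct w (g i)) ∈ M := by
      intro w hw hwr
      obtain ⟨l, hl, hdvd⟩ := exists_linear_form_dvd hwr
      choose D hD using fun i => hdvd (g i)
      rw [funext hD]
      change l • D ∈ M
      rcases eq_or_ne l 0 with rfl | hl0
      · rw [zero_smul]; exact M.zero_mem
      refine M.smul_mem l (ih D (fun i => ?_) ?_)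
      · by_cases hDi : D i = 0
        · exact Or.inl hDi
        refine Or.inr ?_
        have h1 := totalDegree_mul_of_isDomain hl0 hDi
        rw [← hD, hl.totalDegree hl0] at h1
        have h2 := (totalDegree_sub (g i) (matAct w (g i))).trans
          (max_le le_rfl (totalDegree_matAct_le w (g i)))
        rcases hdeg i with h0 | h3
        · simp [h0] at h1; omega
        · omega
      · apply mul_left_cancel₀ hl0
        rw [Finset.mul_sum, mul_zero]
        calc ∑ i, l * (a i * D i) = ∑ i, (a i * g i - matAct w (a i * g i)) := by
              refine Finset.sum_congr rfl fun i _ => ?_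
              rw [map_mul, ha i w hw, ← mul_sub, hD]
              ring
          _ = 0 := by rw [Finset.sum_sub_distrib, ← map_sum, hg, map_zero, sub_zero]
    have hall : ∀ w ∈ Γ, (fun i => g i - matAct w (g i)) ∈ M := by
      intro w hw
      rw [← hΓ] at hw
      induction hw using Subgroup.closure_induction with
      | mem x hx => exact hrefl x hx.1 hx.2
      | one =>
        simp only [matAct_one, sub_self]
        exact M.zero_mem
      | mul x y hx hy ihx ihy =>
        have hxΓ : x ∈ Γ := hΓ ▸ hx
        have := M.add_mem ihx (matAct_comp_mem_span_invRelations ihy hxΓ)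
        convert this using 1
        funext i
        simp [matAct_mul]
      | inv x hx ihx =>
        have hxΓ : x⁻¹ ∈ Γ := inv_mem (hΓ ▸ hx)
        have := M.neg_mem (matAct_comp_mem_span_invRelations ihx hxΓ)
        convert this using 1
        funext i
        simp [matAct_inv_matAct]
    have hr : (fun i => reynolds Γ (g i)) ∈ M := by
      refine Submodule.subset_span ⟨fun i => reynolds_mem Γ _, ?_⟩
      rw [← map_zero (reynolds Γ), ← hg, map_sum]
      refine Finset.sum_congr rfl fun i _ => ?_
      rw [mul_comm, ← reynolds_mul_right Γ _ (ha i), mul_comm]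
    have hsum : g = (fun i => reynolds Γ (g i)) +
        (C (Fintype.card Γ : k)⁻¹ : MvPolynomial (Fin n) k) • ∑ w : Γ, fun i => g i -
          matAct (w : Matrix.GeneralLinearGroup (Fin n) k) (g i) := by
      funext i
      simp only [Pi.add_apply, Pi.smul_apply, Finset.sum_apply, smul_eq_mul, ← smul_eq_C_mul]
      rw [Finset.sum_sub_distrib, smul_sub, reynolds_const_sum, reynolds_apply,
        add_sub_cancel]
    rw [hsum]
    exact M.add_mem hr (M.smul_mem _ (M.sum_mem fun w _ => hall w w.2))

end Flatness

section Chevalley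

lemma derivation_aeval {R M ι : Type} [CommRing R] [Algebra k R] [AddCommGroup M] [Module R M]
    [Module k M] [IsScalarTower k R M] [Fintype ι] (D : Derivation k R M) (f : ι → R)
    (h : MvPolynomial ι k) :
    D (aeval f h) = ∑ i, aeval f (pderiv i h) • D (f i) := by
  classical
  induction h using MvPolynomial.induction_on with
  | C a => simp
  | add p q hp hq => simp [hp, hq, add_smul, Finset.sum_add_distrib]
  | mul_X p i hp =>
    simp only [map_mul, aeval_X, Derivation.leibniz, hp, pderiv_X, smul_eq_mul, map_add, add_smul,
      Finset.sum_add_distrib, Finset.smul_sum, mul_smul]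
    congr 1
    rw [Finset.sum_eq_single i] <;> simp +contextual [eq_comm]

lemma totalDegree_pderiv_lt {ι : Type} {h : MvPolynomial ι k} {i : ι} (hi : pderiv i h ≠ 0) :
    (pderiv i h).totalDegree < h.totalDegree := by
  classical
  rw [totalDegree, Finset.sup_lt_iff]
  · intro s hs
    rw [mem_support_iff, coeff_pderiv] at hs
    have h1 : s + Finsupp.single i 1 ∈ h.support :=
      mem_support_iff.mpr (left_ne_zero_of_mul hs)
    refine lt_of_lt_of_le ?_ (le_totalDegree h1)
    rw [Finsupp.sum_add_index' (fun _ => rfl) (fun _ _ _ => rfl)]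
    simp
  · obtain ⟨s, hs⟩ := ne_zero_iff.mp hi
    rw [coeff_pderiv] at hs
    refine lt_of_lt_of_le ?_ (le_totalDegree (mem_support_iff.mpr (left_ne_zero_of_mul hs)))
    rw [Finsupp.sum_add_index' (fun _ => rfl) (fun _ _ _ => rfl)]
    simp

lemma exists_pderiv_ne_zero [CharZero k] {ι : Type} {h : MvPolynomial ι k}
    (hh : ∀ c, h ≠ C c) : ∃ i, pderiv i h ≠ 0 := by
  classical
  by_contra! H
  refine hh (coeff 0 h) (MvPolynomial.ext _ _ fun s => ?_)
  rw [coeff_C]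
  split_ifs with hs
  · rw [hs]
  obtain ⟨i, hi⟩ := Finsupp.ne_iff.mp (Ne.symm hs)
  have h1 := congrArg (coeff (s - Finsupp.single i 1)) (H i)
  rw [coeff_pderiv, tsub_add_cancel_of_le (Finsupp.single_le_iff.mpr (Nat.one_le_iff_ne_zero.mpr hi)),
    coeff_zero] at h1
  refine (mul_eq_zero.mp h1).resolve_right ?_
  exact Nat.cast_add_one_ne_zero _

/-- A polynomial relation of least degree gives a linear relation between the gradients. -/
lemma algebraicIndependent_of_gradient [CharZero k] {n : ℕ} {ι : Type} [Fintype ι]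
    {f : ι → MvPolynomial (Fin n) k}
    (H : ∀ a : ι → MvPolynomial (Fin n) k, (∀ i, a i ∈ Algebra.adjoin k (Set.range f)) →
      (∀ j, ∑ i, a i * pderiv j (f i) = 0) → a = 0) : AlgebraicIndependent k f := by
  rw [algebraicIndependent_iff]
  suffices ∀ N, ∀ h : MvPolynomial ι k, h.totalDegree < N → aeval f h = 0 → h = 0 from
    fun h => this _ h (Nat.lt_succ_self _)
  intro N
  induction N with
  | zero => exact fun h hN => absurd hN (Nat.not_lt_zero _)
  | succ N ih =>
    intro h hN hh
    have key : (fun i => aeval f (pderiv i h)) = 0 := by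
      refine H _ (fun i => ?_) fun j => ?_
      · rw [Algebra.adjoin_range_eq_range_aeval]
        exact ⟨_, rfl⟩
      · have := derivation_aeval (pderiv j) f h
        rw [hh, map_zero] at this
        simpa using this.symm
    by_contra h0
    have hc : ∀ c, h ≠ C c := by
      rintro c rfl
      simp only [aeval_C, MvPolynomial.algebraMap_eq, C_eq_zero] at hh
      exact h0 (by rw [hh, C_0])
    obtain ⟨i, hi⟩ := exists_pderiv_ne_zero hc
    have h1 := totalDegree_pderiv_lt hi
    exact hi (ih _ (by omega) (congrFun key i))

variable {n : ℕ} {Γ : Subgroup (Matrix.GeneralLinearGroup (Fin n) k)} [CharZero k]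
  {ι : Type} [Fintype ι]

lemma sum_reynolds_mem_sqSpan [Fintype Γ] {a : ι → MvPolynomial (Fin n) k} {l : ι → k}
    (hl : ∀ y ∈ invRelations Γ a, ∑ i, l i * constantCoeff (y i) = 0)
    {z : ι → MvPolynomial (Fin n) k}
    (hz : z ∈ Submodule.span (MvPolynomial (Fin n) k)
      (invRelations Γ a : Set (ι → MvPolynomial (Fin n) k)))
    {b : MvPolynomial (Fin n) k} (hb : constantCoeff b = 0) :
    ∑ i, l i • reynolds Γ (b * z i) ∈ sqSpan Γ := by
  induction hz using Submodule.span_induction generalizing b with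
  | mem y hy =>
    obtain ⟨h1, -⟩ := (mem_invRelations Γ).mp hy
    have : ∑ i, l i • reynolds Γ (b * y i) = reynolds Γ b * ∑ i, l i • y i := by
      rw [Finset.mul_sum]
      refine Finset.sum_congr rfl fun i _ => ?_
      rw [reynolds_mul_right Γ _ (h1 i), mul_smul_comm]
    rw [this]
    refine mul_mem_sqSpan ⟨reynolds_mem Γ _, ?_⟩ ⟨sum_mem fun i _ => Subalgebra.smul_mem _ (h1 i) _, ?_⟩
    · rw [constantCoeff_reynolds, hb]
    · simpa [smul_eq_C_mul] using hl y hy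
  | zero => simp
  | add x y _ _ hx hy =>
    simp only [Pi.add_apply, mul_add, map_add, smul_add, Finset.sum_add_distrib]
    exact add_mem (hx hb) (hy hb)
  | smul c x _ hx =>
    simp only [Pi.smul_apply, smul_eq_mul, ← mul_assoc]
    exact hx (by rw [map_mul, hb, zero_mul])

/-- Homogeneous invariants of a reflection group that are linearly independent modulo products
have linearly independent gradients. -/
lemma eq_zero_of_sum_mul_pderiv_eq_zero [Finite Γ] (hΓ : IsReflectionGroup Γ) {d : Fin n → ℕ}
    {f : ι → MvPolynomial (Fin n) k} (hf : ∀ i, f i ∈ homogInvariants Γ d)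
    (hind : LinearIndependent k ((sqSpan Γ).mkQ ∘ f))
    {a : ι → MvPolynomial (Fin n) k} (ha : ∀ i, a i ∈ invariants Γ)
    (h : ∀ j, ∑ i, a i * pderiv j (f i) = 0) : a = 0 := by
  classical
  have := Fintype.ofFinite Γ
  choose δ hδ hfδ using fun i => (hf i).2
  let ev : (ι → MvPolynomial (Fin n) k) →ₗ[k] (ι → k) :=
    LinearMap.pi fun i => (MvPolynomial.lcoeff k 0) ∘ₗ LinearMap.proj i
  have hev : ∀ y i, ev y i = constantCoeff (y i) := fun y i => rfl
  have htop : (invRelations Γ a).map ev = ⊤ := by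
    by_contra hne
    obtain ⟨ψ, hψ0, hψ⟩ := Submodule.exists_le_ker_of_lt_top _ (lt_top_iff_ne_top.mpr hne)
    set l : ι → k := fun i => ψ fun j => if i = j then 1 else 0 with hl
    have hψl : ∀ v, ψ v = ∑ i, l i * v i := fun v => by
      rw [LinearMap.pi_apply_eq_sum_univ]
      exact Finset.sum_congr rfl fun i _ => mul_comm _ _
    have hl0 : ∀ y ∈ invRelations Γ a, ∑ i, l i * constantCoeff (y i) = 0 := fun y hy => by
      have := hψ (Submodule.mem_map_of_mem hy)
      rw [LinearMap.mem_ker, hψl] at this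
      simpa only [hev] using this
    have hsum : ∑ i, (l i * δ i) • f i ∈ sqSpan Γ := by
      have h1 : ∀ i, (l i * δ i) • f i =
          ∑ j, l i • reynolds Γ ((C (d j : k) * X j) * pderiv j (f i)) := fun i => by
        rw [← Finset.smul_sum, ← map_sum, mul_smul]
        congr 1
        have h2 := (hfδ i).sum_weight_X_mul_pderiv
        rw [← reynolds_eq_self Γ (hf i).1, ← map_smul, reynolds_eq_self Γ (hf i).1]
        congr 1
        rw [Nat.cast_smul_eq_nsmul, ← h2]
        refine Finset.sum_congr rfl fun j _ => ?_
        rw [mul_assoc, ← smul_eq_C_mul, Nat.cast_smul_eq_nsmul]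
      rw [Finset.sum_congr rfl fun i _ => h1 i, Finset.sum_comm]
      refine sum_mem fun j _ => ?_
      exact sum_reynolds_mem_sqSpan hl0 (mem_span_invRelations hΓ ha (h j)) (by simp)
    have hz := Fintype.linearIndependent_iff.mp hind (fun i => l i * δ i) (by
      rw [← (Submodule.Quotient.mk_eq_zero _).mpr hsum, ← Submodule.mkQ_apply, map_sum]
      simp only [map_smul, Function.comp_apply])
    apply hψ0
    ext i
    have h3 : l i = 0 := (mul_eq_zero.mp (hz i)).resolve_right (Nat.cast_ne_zero.mpr (hδ i).ne')
    simp [hψl, Pi.single_apply, h3]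
  choose Y hY hYe using fun i => Submodule.mem_map.mp
    (htop ▸ Submodule.mem_top : (Pi.single i 1 : ι → k) ∈ (invRelations Γ a).map ev)
  let M : Matrix ι ι (MvPolynomial (Fin n) k) := Matrix.of Y
  have hdet : constantCoeff M.det = 1 := by
    rw [RingHom.map_det]
    have : constantCoeff.mapMatrix M = (1 : Matrix ι ι k) := by
      ext i j
      rw [RingHom.mapMatrix_apply, Matrix.map_apply]
      change constantCoeff (Y i j) = _
      rw [← hev, hYe, Matrix.one_apply, Pi.single_apply]
      simp only [eq_comm]
    rw [this, Matrix.det_one]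
  have hdet0 : M.det ≠ 0 := fun h0 => by
    rw [h0, map_zero] at hdet
    exact zero_ne_one hdet
  refine Matrix.eq_zero_of_mulVec_eq_zero hdet0 (funext fun i => ?_)
  have := ((mem_invRelations Γ).mp (hY i)).2
  simpa [M, Matrix.mulVec, dotProduct, mul_comm] using this

/-- The theorem of Chevalley. -/
lemma algebraicIndependent_of_linearIndependent [Finite Γ] (hΓ : IsReflectionGroup Γ)
    {d : Fin n → ℕ} {f : ι → MvPolynomial (Fin n) k} (hf : ∀ i, f i ∈ homogInvariants Γ d)
    (hind : LinearIndependent k ((sqSpan Γ).mkQ ∘ f)) : AlgebraicIndependent k f :=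
  algebraicIndependent_of_gradient fun _ ha h =>
    eq_zero_of_sum_mul_pderiv_eq_zero hΓ hf hind (fun i => Algebra.adjoin_le
      (S := invariants Γ) (by rintro _ ⟨i, rfl⟩; exact (hf i).1) (ha i)) h

end Chevalley

lemma card_le_of_algebraicIndependent {n : ℕ} {ι : Type} {f : ι → MvPolynomial (Fin n) k}
    (hf : AlgebraicIndependent k f) : Nat.card ι ≤ n ∧ Finite ι := by
  have := hf.cardinalMk_le_trdeg
  rw [trdeg_of_isDomain] at this
  simp only [Cardinal.mk_fintype, Fintype.card_fin, Cardinal.lift_natCast] at this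
  have hfin : Finite ι := Cardinal.lt_aleph0_iff_finite.mp (this.trans_lt Cardinal.natCast_lt_aleph0)
  refine ⟨?_, hfin⟩
  rw [← Nat.cast_card] at this
  exact_mod_cast this

lemma card_le_of_linearIndependent [CharZero k] {n : ℕ}
    {Γ : Subgroup (Matrix.GeneralLinearGroup (Fin n) k)} {ι : Type} [Finite Γ] (hΓ : IsReflectionGroup Γ)
    {d : Fin n → ℕ} {f : ι → MvPolynomial (Fin n) k} (hf : ∀ i, f i ∈ homogInvariants Γ d)
    (hind : LinearIndependent k ((sqSpan Γ).mkQ ∘ f)) : Finite ι ∧ Nat.card ι ≤ n := by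
  have hs : ∀ s : Finset ι, s.card ≤ n := fun s => by
    have := (card_le_of_algebraicIndependent (algebraicIndependent_of_linearIndependent hΓ
      (f := fun i : s => f i) (fun i => hf i) (hind.comp _ Subtype.val_injective))).1
    simpa using this
  have hfin : Finite ι := by
    by_contra hinf
    rw [not_finite_iff_infinite] at hinf
    obtain ⟨s, hs'⟩ := Infinite.exists_subset_card_eq ι (n + 1)
    have := hs s
    omega
  have := Fintype.ofFinite ι
  exact ⟨hfin, by rw [Nat.card_eq_fintype_card]; exact hs Finset.univ⟩

section Separation

variable {n : ℕ} (Γ : Subgroup (Matrix.GeneralLinearGroup (Fin n) k)) [Fintype Γ]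

/-- The orbit of a polynomial under a finite linear group. -/
def orbitFinset (b : MvPolynomial (Fin n) k) : Finset (MvPolynomial (Fin n) k) := by
  classical
  exact Finset.univ.image fun g : Γ => matAct (g : Matrix.GeneralLinearGroup (Fin n) k) b

variable {Γ}

lemma mem_orbitFinset {b y : MvPolynomial (Fin n) k} :
    y ∈ orbitFinset Γ b ↔ ∃ g ∈ Γ, matAct g b = y := by
  simp [orbitFinset]

lemma self_mem_orbitFinset (b : MvPolynomial (Fin n) k) : b ∈ orbitFinset Γ b :=
  mem_orbitFinset.mpr ⟨1, one_mem _, by simp [matAct_one]⟩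

variable (Γ) in
/-- The monic polynomial whose roots form the orbit of `b`. -/
def orbitPoly (b : MvPolynomial (Fin n) k) : Polynomial (MvPolynomial (Fin n) k) :=
  ∏ y ∈ orbitFinset Γ b, (Polynomial.X - Polynomial.C y)

lemma coeff_orbitPoly_mem (b : MvPolynomial (Fin n) k) (i : ℕ) :
    (orbitPoly Γ b).coeff i ∈ invariants Γ := by
  classical
  intro g hg
  have : (orbitPoly Γ b).map (matAct g : MvPolynomial (Fin n) k →+* MvPolynomial (Fin n) k)
      = orbitPoly Γ b := by
    rw [orbitPoly, Polynomial.map_prod]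
    refine Finset.prod_bij (fun y _ => matAct g y) ?_ ?_ ?_ ?_
    · intro y hy
      obtain ⟨h, hh, rfl⟩ := mem_orbitFinset.mp hy
      exact mem_orbitFinset.mpr ⟨g * h, mul_mem hg hh, by rw [matAct_mul]⟩
    · exact fun _ _ _ _ h => matAct_injective g h
    · intro y hy
      obtain ⟨h, hh, rfl⟩ := mem_orbitFinset.mp hy
      refine ⟨matAct (g⁻¹ * h) b, mem_orbitFinset.mpr ⟨_, mul_mem (inv_mem hg) hh, rfl⟩, ?_⟩
      rw [← matAct_mul, mul_inv_cancel_left]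
    · intro y _
      simp
  conv_rhs => rw [← this]
  rw [Polynomial.coeff_map]
  rfl

lemma eval_orbitPoly (a b : MvPolynomial (Fin n) k) :
    (orbitPoly Γ b).eval a = ∏ y ∈ orbitFinset Γ b, (a - y) := by
  simp [orbitPoly, Polynomial.eval_prod]

lemma eval_self_orbitPoly (b : MvPolynomial (Fin n) k) : (orbitPoly Γ b).eval b = 0 := by
  rw [eval_orbitPoly]
  exact Finset.prod_eq_zero (self_mem_orbitFinset b) (sub_self b)

open Classical in
lemma eval_derivative_orbitPoly (b : MvPolynomial (Fin n) k) :
    (orbitPoly Γ b).derivative.eval b = ∏ y ∈ (orbitFinset Γ b).erase b, (b - y) := by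
  rw [orbitPoly, ← Finset.mul_prod_erase _ _ (self_mem_orbitFinset b), Polynomial.derivative_mul]
  simp [Polynomial.eval_prod]

lemma derivation_eval {R M : Type} [CommRing R] [Algebra k R] [AddCommGroup M] [Module R M]
    [Module k M] (D : Derivation k R M) {P : Polynomial R} (hP : ∀ i, D (P.coeff i) = 0) (b : R) :
    D (P.eval b) = P.derivative.eval b • D b := by
  rw [Polynomial.eval_eq_sum, Polynomial.derivative_eval, Polynomial.sum, Polynomial.sum, map_sum,
    Finset.sum_smul]
  refine Finset.sum_congr rfl fun i _ => ?_
  rw [Derivation.leibniz, hP, smul_zero, add_zero, Derivation.leibniz_pow, mul_smul, mul_smul,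
    Nat.cast_smul_eq_nsmul]

/-- Invariants of a finite group separate the cosets of the group modulo any prime. -/
lemma exists_forall_matAct_sub_mem [CharZero k] {H : Subgroup (Matrix.GeneralLinearGroup (Fin n) k)}
    [Finite H] {s : Matrix.GeneralLinearGroup (Fin n) k} {P : Ideal (MvPolynomial (Fin n) k)}
    (hP : P.IsPrime) (h : ∀ b ∈ invariants H, matAct s b - b ∈ P) :
    ∃ t ∈ H, ∀ a, matAct s a - matAct t a ∈ P := by
  have := Fintype.ofFinite H
  let U : H → Submodule k (MvPolynomial (Fin n) k) := fun t =>
    (P.restrictScalars k).comap ((matAct s).toLinearMap -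
      (matAct (t : Matrix.GeneralLinearGroup (Fin n) k)).toLinearMap)
  have hU : ⋃ t, (U t : Set (MvPolynomial (Fin n) k)) = Set.univ := by
    refine Set.eq_univ_of_forall fun a => ?_
    let q := Ideal.Quotient.mk P
    have h1 : (orbitPoly H a).eval (matAct s a) ∈ P := by
      rw [← Ideal.Quotient.eq_zero_iff_mem]
      have h2 : (orbitPoly H a).map (q.comp (matAct s :
          MvPolynomial (Fin n) k →+* MvPolynomial (Fin n) k)) = (orbitPoly H a).map q := by
        ext i
        rw [Polynomial.coeff_map, Polynomial.coeff_map, RingHom.comp_apply]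
        exact Ideal.Quotient.eq.mpr (h _ (coeff_orbitPoly_mem a i))
      have h3 : q (matAct s ((orbitPoly H a).eval a)) = q ((orbitPoly H a).eval (matAct s a)) := by
        rw [← Polynomial.eval₂_at_apply q, ← Polynomial.eval_map, ← h2, Polynomial.eval_map]
        exact (Polynomial.eval₂_at_apply (q.comp (matAct s :
          MvPolynomial (Fin n) k →+* MvPolynomial (Fin n) k)) a).symm
      change q _ = 0
      rw [← h3, eval_self_orbitPoly, map_zero, map_zero]
    rw [eval_orbitPoly] at h1
    obtain ⟨y, hy, hyP⟩ := (hP.prod_mem_iff).mp h1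
    obtain ⟨t, ht, rfl⟩ := mem_orbitFinset.mp hy
    exact Set.mem_iUnion.mpr ⟨⟨t, ht⟩, hyP⟩
  obtain ⟨t, ht⟩ := Subspace.exists_eq_top_of_iUnion_eq_univ hU
  exact ⟨t, t.2, fun a => (ht ▸ Submodule.mem_top : a ∈ U t)⟩

/-- The Galois correspondence for invariant rings of finite linear groups. -/
lemma mem_of_forall_invariants [CharZero k] {H : Subgroup (Matrix.GeneralLinearGroup (Fin n) k)}
    [Finite H] {s : Matrix.GeneralLinearGroup (Fin n) k}
    (h : ∀ b ∈ invariants H, matAct s b = b) : s ∈ H := by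
  obtain ⟨t, ht, h1⟩ := exists_forall_matAct_sub_mem (P := ⊥) (H := H) (s := s)
    Ideal.isPrime_bot fun b hb => by rw [h b hb, sub_self]; exact zero_mem _
  rwa [eq_of_matAct_X_eq fun i => sub_eq_zero.mp (Ideal.mem_bot.mp (h1 (X i)))]

/-- Unramifiedness of `k[V]^H` over `k[V]^Γ` at a prime not ramified by `Γ \ H`. -/
lemma exists_smul_derivation_eq_zero [CharZero k] {M : Type} [AddCommGroup M]
    [Module (MvPolynomial (Fin n) k) M] [Module k M] [IsScalarTower k (MvPolynomial (Fin n) k) M]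
    (D : Derivation k (MvPolynomial (Fin n) k) M) (hD : ∀ c ∈ invariants Γ, D c = 0)
    {H : Subgroup (Matrix.GeneralLinearGroup (Fin n) k)}
    {P : Ideal (MvPolynomial (Fin n) k)} (hP : P.IsPrime)
    (hsep : ∀ s ∈ Γ, (∀ b ∈ invariants H, matAct s b - b ∈ P) → s ∈ H)
    {b : MvPolynomial (Fin n) k} (hb : b ∈ invariants H) : ∃ s ∉ P, s • D b = 0 := by
  classical
  let K : Submodule k (MvPolynomial (Fin n) k) :=
    { carrier := {b | ∃ s ∉ P, s • D b = 0}
      add_mem' := by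
        rintro x y ⟨s, hs, hsx⟩ ⟨t, ht, hty⟩
        refine ⟨s * t, fun h => (hP.mem_or_mem h).elim hs ht, ?_⟩
        rw [map_add, smul_add, mul_smul, mul_smul, hty, smul_comm, hsx]
        simp
      zero_mem' := ⟨1, hP.one_notMem, by simp⟩
      smul_mem' := by
        rintro c x ⟨s, hs, hsx⟩
        exact ⟨s, hs, by rw [Derivation.map_smul, smul_comm, hsx, smul_zero]⟩ }
  let V : Submodule k (MvPolynomial (Fin n) k) := Subalgebra.toSubmodule (invariants H)
  let U : Option {g : Γ // (g : Matrix.GeneralLinearGroup (Fin n) k) ∉ H} → Submodule k V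
    | none => K.comap V.subtype
    | some g => ((P.restrictScalars k).comap
        ((matAct (g : Matrix.GeneralLinearGroup (Fin n) k)).toLinearMap - LinearMap.id)).comap
          V.subtype
  have hU : ⋃ t, (U t : Set V) = Set.univ := by
    refine Set.eq_univ_of_forall fun ⟨x, hx⟩ => ?_
    by_cases hex : ∃ g : {g : Γ // (g : Matrix.GeneralLinearGroup (Fin n) k) ∉ H},
        matAct (g : Matrix.GeneralLinearGroup (Fin n) k) x - x ∈ P
    · obtain ⟨g, hg⟩ := hex
      exact Set.mem_iUnion.mpr ⟨some g, hg⟩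
    · push Not at hex
      refine Set.mem_iUnion.mpr ⟨none, (orbitPoly Γ x).derivative.eval x, ?_, ?_⟩
      · rw [eval_derivative_orbitPoly]
        intro hmem
        obtain ⟨y, hy, hyP⟩ := (hP.prod_mem_iff).mp hmem
        obtain ⟨hne, hy⟩ := Finset.mem_erase.mp hy
        obtain ⟨g, hg, rfl⟩ := mem_orbitFinset.mp hy
        by_cases hgH : g ∈ H
        · exact hne (hx g hgH)
        · exact hex ⟨⟨g, hg⟩, hgH⟩ (by rw [← neg_sub]; exact P.neg_mem hyP)
      · change _ • D x = 0
        rw [← derivation_eval D (fun i => hD _ (coeff_orbitPoly_mem x i)), eval_self_orbitPoly,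
          map_zero]
  obtain ⟨t, ht⟩ := Subspace.exists_eq_top_of_iUnion_eq_univ hU
  rcases t with _ | ⟨g, hg⟩
  · exact (ht ▸ Submodule.mem_top : (⟨b, hb⟩ : V) ∈ U none)
  · exact absurd (hsep g g.2 fun x hx =>
      (ht ▸ Submodule.mem_top : (⟨x, hx⟩ : V) ∈ U (some ⟨g, hg⟩))) hg

end Separation

section Converse

lemma dvd_of_forall_irreducible {R : Type} [CommRing R] [IsDomain R] [UniqueFactorizationMonoid R]
    {x y : R} (hx : x ≠ 0) (h : ∀ q, Irreducible q → ∃ s, ¬ q ∣ s ∧ x ∣ s * y) : x ∣ y := by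
  obtain ⟨x', y', c, hrel, rfl, rfl⟩ := UniqueFactorizationMonoid.exists_reduced_factors x hx y
  by_cases hu : IsUnit x'
  · exact mul_dvd_mul_left c hu.dvd
  · obtain ⟨q, hq, hqx⟩ := WfDvdMonoid.exists_irreducible_factor hu (right_ne_zero_of_mul hx)
    obtain ⟨s, hs, hsy⟩ := h q hq
    rw [mul_left_comm] at hsy
    have h1 := hqx.trans ((mul_dvd_mul_iff_left (left_ne_zero_of_mul hx)).mp hsy)
    have h2 := (hq.prime.dvd_or_dvd h1).resolve_left hs
    exact absurd (hrel hqx h2) hq.not_isUnit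

variable {n : ℕ}

/-- The gradient derivation. -/
def grad : Derivation k (MvPolynomial (Fin n) k) (Fin n → MvPolynomial (Fin n) k) :=
  mkDerivation k fun i => Pi.single i 1

lemma grad_apply (f : MvPolynomial (Fin n) k) (j : Fin n) : grad f j = pderiv j f := by
  let D : Derivation k (MvPolynomial (Fin n) k) (MvPolynomial (Fin n) k) :=
    (LinearMap.proj j : (Fin n → MvPolynomial (Fin n) k) →ₗ[MvPolynomial (Fin n) k]
      MvPolynomial (Fin n) k).compDer grad
  have : D = pderiv j := derivation_ext fun i => by
    change grad (X i) j = _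
    rw [grad, mkDerivation_X, pderiv_X, Pi.single_comm]
  exact DFunLike.congr_fun this f

lemma adjoin_range_extend {ι κ : Type} (e : ι ↪ κ) (f : ι → MvPolynomial (Fin n) k) :
    Algebra.adjoin k (Set.range (Function.extend e f 0)) = Algebra.adjoin k (Set.range f) := by
  apply le_antisymm <;> refine Algebra.adjoin_le ?_
  · rintro _ ⟨j, rfl⟩
    by_cases hj : ∃ i, e i = j
    · obtain ⟨i, rfl⟩ := hj
      rw [e.injective.extend_apply]
      exact Algebra.subset_adjoin ⟨i, rfl⟩
    · rw [Function.extend_apply' _ _ _ hj]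
      exact zero_mem _
  · rintro _ ⟨i, rfl⟩
    exact Algebra.subset_adjoin ⟨e i, e.injective.extend_apply _ _ _⟩

/-- The Jacobian matrix. -/
def jacobian (f : Fin n → MvPolynomial (Fin n) k) :
    Matrix (Fin n) (Fin n) (MvPolynomial (Fin n) k) :=
  Matrix.of fun i => grad (f i)

lemma mem_span_grad_iff {f : Fin n → MvPolynomial (Fin n) k} {v : Fin n → MvPolynomial (Fin n) k} :
    v ∈ Submodule.span (MvPolynomial (Fin n) k) (Set.range fun i => grad (f i)) ↔
      ∃ a, (jacobian f).transpose.mulVec a = v := by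
  rw [Submodule.mem_span_range_iff_exists_fun]
  refine exists_congr fun a => ?_
  rw [Matrix.mulVec_transpose, Matrix.vecMul_eq_sum]
  rfl

lemma isReflection_of_dvd {q : MvPolynomial (Fin n) k} (hq : ¬ IsUnit q)
    {g : Matrix.GeneralLinearGroup (Fin n) k} (hg : IsOfFinOrder g) (hg1 : g ≠ 1)
    (h : ∀ i, q ∣ X i - matAct g (X i)) : IsReflection (g : Matrix (Fin n) (Fin n) k) := by
  classical
  have hq0 : q ≠ 0 := by
    rintro rfl
    refine hg1 (eq_of_matAct_X_eq fun i => ?_)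
    rw [matAct_one, ← sub_eq_zero, ← neg_sub, zero_dvd_iff.mp (h i), neg_zero]
  have hdeg : q.totalDegree ≠ 0 := by
    intro h0
    rw [totalDegree_eq_zero_iff_eq_C] at h0
    apply hq
    rw [h0] at hq0 ⊢
    exact (isUnit_iff_ne_zero.mpr fun h => hq0 (by rw [h, C_0])).map C
  choose r hr using h
  have hrC : ∀ i, r i = C (coeff 0 (r i)) := fun i => by
    by_cases h0 : r i = 0
    · rw [h0, coeff_zero, C_0]
    · rw [← totalDegree_eq_zero_iff_eq_C]
      have h1 := totalDegree_mul_of_isDomain hq0 h0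
      rw [← hr] at h1
      have h2 : (X i - matAct g (X i)).totalDegree ≤ 1 :=
        ((isHomogeneous_X k i).sub (matAct_isHomogeneous g (isHomogeneous_X k i))).totalDegree_le
      omega
  refine isReflection_of_mul hg hg1 (v := fun i => - coeff 0 (r i))
    (c := fun j => coeff (Finsupp.single j 1) q) fun i j => ?_
  have h1 := congrArg (coeff (Finsupp.single j 1)) (hr i)
  rw [hrC i, mul_comm, coeff_C_mul, matAct_X, coeff_sub, coeff_sum] at h1
  simp only [coeff_smul, coeff_X, Finsupp.single_left_inj one_ne_zero, smul_eq_mul, mul_ite,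
    mul_one, mul_zero, Finset.sum_ite_eq', Finset.mem_univ, if_true] at h1
  rw [neg_mul, ← h1, neg_sub, Matrix.one_apply]

/-- The subgroup generated by the reflections of `Γ`. -/
def reflSubgroup (Γ : Subgroup (Matrix.GeneralLinearGroup (Fin n) k)) :
    Subgroup (Matrix.GeneralLinearGroup (Fin n) k) :=
  Subgroup.closure {g | g ∈ Γ ∧ IsReflection ((g : Matrix (Fin n) (Fin n) k))}

lemma reflSubgroup_le {Γ : Subgroup (Matrix.GeneralLinearGroup (Fin n) k)} : reflSubgroup Γ ≤ Γ :=
  (Subgroup.closure_le _).mpr fun _ h => h.1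

variable {Γ : Subgroup (Matrix.GeneralLinearGroup (Fin n) k)} [Finite Γ] [CharZero k]

lemma exists_smul_grad_mem {ι : Type} {f : ι → MvPolynomial (Fin n) k}
    (hf : Algebra.adjoin k (Set.range f) = invariants Γ)
    {H : Subgroup (Matrix.GeneralLinearGroup (Fin n) k)}
    {P : Ideal (MvPolynomial (Fin n) k)} (hP : P.IsPrime)
    (hsep : ∀ s ∈ Γ, (∀ b ∈ invariants H, matAct s b - b ∈ P) → s ∈ H)
    {b : MvPolynomial (Fin n) k} (hb : b ∈ invariants H) :
    ∃ s ∉ P, s • grad b ∈ Submodule.span (MvPolynomial (Fin n) k)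
      (Set.range fun i => grad (f i)) := by
  have := Fintype.ofFinite Γ
  set N := Submodule.span (MvPolynomial (Fin n) k) (Set.range fun i => grad (f i)) with hN
  obtain ⟨s, hs, h⟩ := exists_smul_derivation_eq_zero (N.mkQ.compDer grad) (Γ := Γ)
    (fun c hc => by
      rw [← hf] at hc
      refine Derivation.eqOn_adjoin (D2 := 0) ?_ hc
      rintro _ ⟨i, rfl⟩
      exact (Submodule.Quotient.mk_eq_zero N).mpr (Submodule.subset_span ⟨i, rfl⟩)) hP hsep hb
  refine ⟨s, hs, (Submodule.Quotient.mk_eq_zero N).mp ?_⟩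
  exact h

lemma det_jacobian_ne_zero {f : Fin n → MvPolynomial (Fin n) k}
    (hf : Algebra.adjoin k (Set.range f) = invariants Γ) : (jacobian f).transpose.det ≠ 0 := by
  intro h0
  rw [← Matrix.exists_vecMul_eq_zero_iff] at h0
  obtain ⟨v, hv, h⟩ := h0
  apply hv
  funext i
  obtain ⟨s, hs, hmem⟩ := exists_smul_grad_mem (b := X i) hf (H := ⊥) (P := ⊥) Ideal.isPrime_bot
    (fun s _ hs => by
      rw [Subgroup.mem_bot]
      refine eq_of_matAct_X_eq fun j => ?_
      rw [matAct_one]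
      refine sub_eq_zero.mp (Ideal.mem_bot.mp (hs _ ?_))
      rintro g rfl
      exact matAct_one _)
    (by rintro g rfl; exact matAct_one _)
  obtain ⟨a, ha⟩ := mem_span_grad_iff.mp hmem
  have h1 := congrArg (v ⬝ᵥ ·) ha
  simp only [Matrix.dotProduct_mulVec, h, zero_dotProduct] at h1
  rw [grad, mkDerivation_X, dotProduct_smul, dotProduct_single, mul_one, smul_eq_mul] at h1
  exact (mul_eq_zero.mp h1.symm).resolve_left fun h => hs (h ▸ zero_mem _)

/-- The invariants of a finite group on `k^n` need at least `n` generators. -/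
lemma le_card_of_adjoin_eq_invariants {ι : Type} [Fintype ι] {f : ι → MvPolynomial (Fin n) k}
    (hf : Algebra.adjoin k (Set.range f) = invariants Γ) : n ≤ Fintype.card ι := by
  by_contra! hlt
  let e : ι ↪ Fin n := (Fintype.equivFin ι).toEmbedding.trans (Fin.castLEEmb hlt.le)
  have h1 := det_jacobian_ne_zero ((adjoin_range_extend e f).trans hf)
  rw [Matrix.det_transpose] at h1
  apply h1
  refine Matrix.det_eq_zero_of_row_eq_zero ⟨Fintype.card ι, hlt⟩ fun j => ?_
  have : Function.extend e f 0 ⟨Fintype.card ι, hlt⟩ = 0 := by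
    refine Function.extend_apply' _ _ _ ?_
    rintro ⟨i, hi⟩
    have h2 : ((Fintype.equivFin ι i : Fin _) : ℕ) = Fintype.card ι := congrArg Fin.val hi
    exact absurd h2 (Fintype.equivFin ι i).2.ne
  rw [jacobian, Matrix.of_apply, this, map_zero, Pi.zero_apply]

lemma mem_reflSubgroup_of_forall_mem {q : MvPolynomial (Fin n) k} (hq : Irreducible q)
    {s : Matrix.GeneralLinearGroup (Fin n) k} (hs : s ∈ Γ)
    (h : ∀ b ∈ invariants (reflSubgroup Γ), matAct s b - b ∈ Ideal.span {q}) :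
    s ∈ reflSubgroup Γ := by
  have : Finite (reflSubgroup Γ) := Finite.Set.subset (Γ : Set _) reflSubgroup_le
  obtain ⟨t, ht, h1⟩ := exists_forall_matAct_sub_mem
    ((Ideal.span_singleton_prime hq.ne_zero).mpr hq.prime) h
  have h2 : ∀ i, q ∣ X i - matAct (s * t⁻¹) (X i) := fun i => by
    rw [← Ideal.mem_span_singleton, ← neg_sub, matAct_mul]
    have := h1 (matAct t⁻¹ (X i))
    rw [matAct_matAct_inv] at this
    exact neg_mem this
  by_cases h3 : s * t⁻¹ = 1
  · rw [mul_inv_eq_one.mp h3]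
    exact ht
  · have hmem : s * t⁻¹ ∈ Γ := mul_mem hs (inv_mem (reflSubgroup_le ht))
    have h4 : s * t⁻¹ ∈ reflSubgroup Γ := Subgroup.subset_closure ⟨hmem,
      isReflection_of_dvd hq.not_isUnit
        (Γ.subtype.isOfFinOrder (isOfFinOrder_of_finite (⟨_, hmem⟩ : Γ))) h3 h2⟩
    exact (Subgroup.mul_mem_cancel_right _ (inv_mem ht)).mp h4

lemma exists_mulVec_eq_grad {f : Fin n → MvPolynomial (Fin n) k}
    (hf : Algebra.adjoin k (Set.range f) = invariants Γ)
    {b : MvPolynomial (Fin n) k} (hb : b ∈ invariants (reflSubgroup Γ)) :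
    ∃ a, (jacobian f).transpose.mulVec a = grad b := by
  set J := (jacobian f).transpose with hJ
  have hdet : J.det ≠ 0 := det_jacobian_ne_zero hf
  have h1 : ∀ i, J.det ∣ J.adjugate.mulVec (grad b) i := fun i => by
    refine dvd_of_forall_irreducible hdet fun q hq => ?_
    obtain ⟨s, hs, hmem⟩ := exists_smul_grad_mem hf (H := reflSubgroup Γ)
      ((Ideal.span_singleton_prime hq.ne_zero).mpr hq.prime)
      (fun s hs h => mem_reflSubgroup_of_forall_mem hq hs h) hb
    obtain ⟨a, ha⟩ := mem_span_grad_iff.mp hmem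
    refine ⟨s, fun h => hs (Ideal.mem_span_singleton.mpr h), a i, ?_⟩
    have h2 := congrArg (J.adjugate.mulVec ·) ha
    simp only [← hJ, Matrix.mulVec_mulVec, Matrix.adjugate_mul, Matrix.smul_mulVec,
      Matrix.one_mulVec, Matrix.mulVec_smul] at h2
    exact (congrFun h2 i).symm
  choose a ha using h1
  refine ⟨a, ?_⟩
  have h3 : J.det • J.mulVec a = J.det • grad b := by
    rw [← Matrix.mulVec_smul]
    have : J.det • a = J.adjugate.mulVec (grad b) := funext fun i => (ha i).symm
    rw [this, Matrix.mulVec_mulVec, Matrix.mul_adjugate, Matrix.smul_mulVec, Matrix.one_mulVec]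
  funext i
  exact mul_left_cancel₀ hdet (congrFun h3 i)

lemma posInvariants_reflSubgroup_subset {f : Fin n → MvPolynomial (Fin n) k} {d : Fin n → ℕ}
    (hd : ∀ i, (f i).IsHomogeneous (d i)) (hf : Algebra.adjoin k (Set.range f) = invariants Γ) :
    posInvariants (reflSubgroup Γ) ≤ (Ideal.span (Set.range f)).restrictScalars k := by
  rw [posInvariants_eq_span (preservesWeights_one _) fun _ => one_pos, Submodule.span_le]
  rintro b ⟨hb, e, he, hbe⟩
  obtain ⟨a, ha⟩ := exists_mulVec_eq_grad hf hb
  have euler : ∀ {g : MvPolynomial (Fin n) k} {r : ℕ}, g.IsHomogeneous r →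
      ∑ j, X j * grad g j = C (r : k) * g := fun {g r} hg => by
    have := IsWeightedHomogeneous.sum_weight_X_mul_pderiv hg
    simp only [Pi.one_apply, one_smul] at this
    simp only [grad_apply, this]
    rw [← smul_eq_C_mul, Nat.cast_smul_eq_nsmul]
  have h1 : C (e : k) * b ∈ Ideal.span (Set.range f) := by
    rw [← euler hbe, ← ha]
    have : ∑ j, X j * (jacobian f).transpose.mulVec a j
        = ∑ i, a i * C (d i : k) * f i := by
      simp only [Matrix.mulVec, dotProduct, Finset.mul_sum, Matrix.transpose_apply]
      rw [Finset.sum_comm]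
      refine Finset.sum_congr rfl fun i _ => ?_
      rw [mul_assoc, ← euler (hd i), Finset.mul_sum]
      refine Finset.sum_congr rfl fun j _ => ?_
      simp only [jacobian, Matrix.of_apply]
      ring
    rw [this]
    exact sum_mem fun i _ => Ideal.mul_mem_left _ _ (Ideal.subset_span ⟨i, rfl⟩)
  have h2 : b = C ((e : k)⁻¹) * (C (e : k) * b) := by
    rw [← mul_assoc, ← C_mul, inv_mul_cancel₀ (Nat.cast_ne_zero.mpr he.ne'), C_1, one_mul]
  change b ∈ Ideal.span (Set.range f)
  rw [h2]
  exact Ideal.mul_mem_left _ _ h1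

/-- The converse of the theorem of Chevalley, due to Shephard and Todd. -/
lemma isReflectionGroup_of_adjoin {f : Fin n → MvPolynomial (Fin n) k} {d : Fin n → ℕ}
    (hd : ∀ i, (f i).IsHomogeneous (d i)) (h0 : ∀ i, constantCoeff (f i) = 0)
    (hf : Algebra.adjoin k (Set.range f) = invariants Γ) : IsReflectionGroup Γ := by
  have : Finite (reflSubgroup Γ) := Finite.Set.subset (Γ : Set _) reflSubgroup_le
  have := Fintype.ofFinite (reflSubgroup Γ)
  have hfinv : ∀ i, f i ∈ invariants Γ := fun i => hf ▸ Algebra.subset_adjoin ⟨i, rfl⟩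
  have hle : invariants Γ ≤ invariants (reflSubgroup Γ) :=
    fun x hx g hg => hx g (reflSubgroup_le hg)
  have approx : ∀ N, ∀ b ∈ invariants (reflSubgroup Γ),
      ∃ c ∈ invariants Γ, b - c ∈ idealPlus k n ^ N := by
    intro N
    induction N with
    | zero => exact fun b _ => ⟨0, zero_mem _, by simp⟩
    | succ N ih =>
      intro b hb
      have h1 : b - C (constantCoeff b) ∈ posInvariants (reflSubgroup Γ) :=
        ⟨sub_mem hb (Subalgebra.algebraMap_mem _ _), by simp⟩
      obtain ⟨a, ha⟩ := (Submodule.mem_span_range_iff_exists_fun _).mp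
        (posInvariants_reflSubgroup_subset hd hf h1)
      choose c hc hca using fun i => ih _ (reynolds_mem (reflSubgroup Γ) (a i))
      refine ⟨C (constantCoeff b) + ∑ i, c i * f i, add_mem (Subalgebra.algebraMap_mem _ _)
        (sum_mem fun i _ => mul_mem (hc i) (hfinv i)), ?_⟩
      have h2 : b - C (constantCoeff b) = ∑ i, reynolds (reflSubgroup Γ) (a i) * f i := by
        rw [← reynolds_eq_self _ h1.1, ← ha, map_sum]
        refine Finset.sum_congr rfl fun i _ => ?_
        rw [smul_eq_mul, reynolds_mul_right _ _ (hle (hfinv i))]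
      rw [← sub_sub, h2, ← Finset.sum_sub_distrib]
      refine sum_mem fun i _ => ?_
      rw [← sub_mul, pow_succ]
      exact Ideal.mul_mem_mul (hca i) (mem_idealPlus_iff.mpr (h0 i))
  have hinv : invariants (reflSubgroup Γ) ≤ invariants Γ := fun b hb =>
    mem_of_sub_mem_pow (K := Subalgebra.toSubmodule (invariants Γ))
      (fun z hz e => weightedHomogeneousComponent_mem_invariants (preservesWeights_one Γ) hz e)
      fun N => approx N b hb
  exact le_antisymm reflSubgroup_le fun s hs => mem_of_forall_invariants
    (H := reflSubgroup Γ) fun b hb => hinv hb s hs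

end Converse

section Setup

variable {n m : ℕ} {Wt G : Subgroup (Matrix.GeneralLinearGroup (Fin n) k)}
  {p : Fin m → MvPolynomial (Fin n) k} {d : Fin m → ℕ} {c : ↥Wt → Fin m → Fin m → k}

namespace QuotSetup

lemma finite_subgroup (hs : QuotSetup Wt G p d c) : Finite G :=
  (hs.finite.subset hs.le).to_subtype

lemma coeff_unique (hs : QuotSetup Wt G p d c) {a b : Fin m → k}
    (h : ∑ j, a j • p j = ∑ j, b j • p j) : a = b := by
  have := hs.minimal (a - b) (by
    simp only [Pi.sub_apply, sub_smul, Finset.sum_sub_distrib, h, sub_self]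
    exact zero_mem _)
  exact sub_eq_zero.mp this

lemma of_mul (hs : QuotSetup Wt G p d c) (u v : Wt) :
    Matrix.of (c (u * v)) = Matrix.of (c v) * Matrix.of (c u) := by
  ext i j
  refine congrFun (hs.coeff_unique (b := fun j => (Matrix.of (c v) * Matrix.of (c u)) i j) ?_) j
  simp only [Matrix.of_apply]
  rw [← hs.equivar, Subgroup.coe_mul, matAct_mul, hs.equivar, map_sum]
  simp only [map_smul, hs.equivar, Matrix.mul_apply, Matrix.of_apply, Finset.smul_sum,
    Finset.sum_smul, mul_smul]
  exact Finset.sum_comm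

lemma of_eq_one (hs : QuotSetup Wt G p d c) {w : Wt}
    (hw : (w : Matrix.GeneralLinearGroup (Fin n) k) ∈ G) : Matrix.of (c w) = 1 := by
  ext i j
  refine congrFun (hs.coeff_unique (b := fun j => (1 : Matrix (Fin m) (Fin m) k) i j) ?_) j
  simp only [Matrix.of_apply]
  rw [← hs.equivar]
  have : p i ∈ invariants G := hs.gen ▸ Algebra.subset_adjoin ⟨i, rfl⟩
  rw [this _ hw]
  simp [Matrix.one_apply]

/-- The induced representation of `W` on the tangent space. -/
def rep (hs : QuotSetup Wt G p d c) : ↥Wt →* Matrix.GeneralLinearGroup (Fin m) k :=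
  MonoidHom.toHomUnits
    { toFun := qMat c
      map_one' := by
        rw [qMat, inv_one]
        exact hs.of_eq_one (one_mem G)
      map_mul' := fun u v => by rw [qMat, mul_inv_rev, hs.of_mul]; rfl }

lemma coe_rep (hs : QuotSetup Wt G p d c) (w : Wt) :
    (hs.rep w : Matrix (Fin m) (Fin m) k) = qMat c w := rfl

lemma polyAct_eq (hs : QuotSetup Wt G p d c) (w : Wt) : polyAct (c w) = matAct (hs.rep w) := by
  rw [polyAct, matAct, ← map_inv, coe_rep, qMat, inv_inv]
  rfl

lemma aeval_matAct (hs : QuotSetup Wt G p d c) (w : Wt) (f : MvPolynomial (Fin m) k) :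
    aeval p (matAct (hs.rep w) f) =
      matAct (w : Matrix.GeneralLinearGroup (Fin n) k) (aeval p f) := by
  rw [← hs.polyAct_eq]
  refine DFunLike.congr_fun (f := (aeval p).comp (polyAct (c w)))
    (g := (matAct (w : Matrix.GeneralLinearGroup (Fin n) k)).comp (aeval p))
    (algHom_ext fun i => ?_) f
  simp [polyAct, hs.equivar]

lemma rep_eq_one_iff [CharZero k] (hs : QuotSetup Wt G p d c) (w : Wt) :
    hs.rep w = 1 ↔ (w : Matrix.GeneralLinearGroup (Fin n) k) ∈ G := by
  have := hs.finite_subgroup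
  constructor
  · intro h
    refine mem_of_forall_invariants fun b hb => ?_
    rw [← hs.gen, Algebra.adjoin_range_eq_range_aeval] at hb
    obtain ⟨f, rfl⟩ := hb
    have := hs.aeval_matAct w f
    rw [h, matAct_one] at this
    exact this.symm
  · intro h
    refine Units.ext ?_
    rw [coe_rep, qMat]
    exact hs.of_eq_one (w := w⁻¹) (inv_mem h)

lemma ker_rep [CharZero k] (hs : QuotSetup Wt G p d c) : hs.rep.ker = G.subgroupOf Wt := by
  ext w
  rw [MonoidHom.mem_ker, hs.rep_eq_one_iff, Subgroup.mem_subgroupOf]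

lemma finite_range (hs : QuotSetup Wt G p d c) : Finite hs.rep.range := by
  have : Finite Wt := hs.finite
  exact Set.finite_range hs.rep

lemma preservesWeights (hs : QuotSetup Wt G p d c) : PreservesWeights hs.rep.range d := by
  rintro _ ⟨w, rfl⟩ f e hf
  rw [← hs.polyAct_eq]
  refine isWeightedHomogeneous_aeval (fun i => ?_) hf
  refine Submodule.sum_mem (weightedHomogeneousSubmodule k d (d i)) fun j _ => ?_
  have h1 : c w i = fun j => if d i = d j then c w i j else 0 := by
    refine hs.coeff_unique ?_
    have h2 := matAct_isHomogeneous (w : Matrix.GeneralLinearGroup (Fin n) k) (hs.homog i)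
    rw [hs.equivar] at h2
    have h3 := homogeneousComponent_of_mem (m := d i) h2
    rw [if_pos rfl, map_sum] at h3
    rw [← h3]
    refine Finset.sum_congr rfl fun j _ => ?_
    rw [map_smul, homogeneousComponent_of_mem (hs.homog j)]
    split_ifs <;> simp
  by_cases hij : d i = d j
  · refine Submodule.smul_mem _ _ ?_
    rw [hij]
    exact isWeightedHomogeneous_X k d j
  · have h2 : c w i j = if d i = d j then c w i j else 0 := congrFun h1 j
    rw [h2, if_neg hij, zero_smul]
    exact zero_mem _

lemma constantCoeff_aeval (hs : QuotSetup Wt G p d c) (f : MvPolynomial (Fin m) k) :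
    constantCoeff (aeval p f) = constantCoeff f := by
  have h0 : ∀ i, constantCoeff (p i) = 0 := fun i =>
    constantCoeff_eq_zero_of_isWeightedHomogeneous (hs.homog i) (hs.dpos i)
  induction f using MvPolynomial.induction_on with
  | C a => simp
  | add f g hf hg => rw [map_add, map_add, map_add, hf, hg]
  | mul_X f i hf => simp [h0]

lemma aeval_mem_invariants (hs : QuotSetup Wt G p d c) {f : MvPolynomial (Fin m) k}
    (hf : f ∈ invariants hs.rep.range) : aeval p f ∈ invariants Wt := fun w hw => by
  rw [← hs.aeval_matAct ⟨w, hw⟩, hf _ ⟨_, rfl⟩]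

lemma exists_aeval_eq [CharZero k] (hs : QuotSetup Wt G p d c) {t : MvPolynomial (Fin n) k}
    (ht : t ∈ invariants Wt) : ∃ f ∈ invariants hs.rep.range, aeval p f = t := by
  have := hs.finite_range
  have := Fintype.ofFinite hs.rep.range
  have h1 : t ∈ invariants G := fun g hg => ht g (hs.le hg)
  rw [← hs.gen, Algebra.adjoin_range_eq_range_aeval] at h1
  obtain ⟨f, rfl⟩ := h1
  refine ⟨reynolds hs.rep.range f, reynolds_mem _ f, ?_⟩
  have h2 : f - reynolds hs.rep.range f ∈ (relIdeal p).restrictScalars k :=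
    sub_reynolds_mem _ (by
      rintro _ ⟨w, rfl⟩
      change aeval p _ = 0
      rw [map_sub, hs.aeval_matAct]
      exact sub_eq_zero.mpr (ht w w.2))
  have h3 : aeval p (f - reynolds hs.rep.range f) = 0 := h2
  rw [map_sub, sub_eq_zero] at h3
  exact h3.symm

lemma map_posInvariants [CharZero k] (hs : QuotSetup Wt G p d c) :
    (posInvariants hs.rep.range).map (aeval p).toLinearMap = posInvariants Wt := by
  ext t
  constructor
  · rintro ⟨f, hf, rfl⟩
    exact ⟨hs.aeval_mem_invariants hf.1, (hs.constantCoeff_aeval f).trans hf.2⟩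
  · intro ht
    obtain ⟨f, hf, rfl⟩ := hs.exists_aeval_eq ht.1
    exact ⟨f, ⟨hf, (hs.constantCoeff_aeval f).symm.trans ht.2⟩, rfl⟩

lemma map_sqSpan [CharZero k] (hs : QuotSetup Wt G p d c) :
    (sqSpan hs.rep.range).map (aeval p).toLinearMap = sqSpan Wt := by
  rw [sqSpan_eq_mul, sqSpan_eq_mul, Submodule.map_mul, hs.map_posInvariants]

lemma map_relIdeal_le (hs : QuotSetup Wt G p d c) {g : Matrix.GeneralLinearGroup (Fin m) k}
    (hg : g ∈ hs.rep.range) {f : MvPolynomial (Fin m) k} (hf : f ∈ relIdeal p) :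
    matAct g f ∈ relIdeal p := by
  obtain ⟨w, rfl⟩ := hg
  change aeval p _ = 0
  rw [hs.aeval_matAct, show aeval p f = 0 from hf, map_zero]

lemma eq_one_of_forall_sub_mem [CharZero k] (hs : QuotSetup Wt G p d c)
    {g : Matrix.GeneralLinearGroup (Fin m) k} (hg : g ∈ hs.rep.range)
    (h : ∀ f, matAct g f - f ∈ relIdeal p) : g = 1 := by
  have := hs.finite_subgroup
  obtain ⟨w, rfl⟩ := hg
  rw [hs.rep_eq_one_iff]
  refine mem_of_forall_invariants fun b hb => ?_
  rw [← hs.gen, Algebra.adjoin_range_eq_range_aeval] at hb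
  obtain ⟨f, rfl⟩ := hb
  have h1 : aeval p (matAct (hs.rep w) f - f) = 0 := h f
  rw [map_sub, hs.aeval_matAct, sub_eq_zero] at h1
  exact h1

lemma constantCoeff_eq_zero_of_mem (hs : QuotSetup Wt G p d c) {f : MvPolynomial (Fin m) k}
    (hf : f ∈ relIdeal p) : constantCoeff f = 0 := by
  rw [← hs.constantCoeff_aeval, show aeval p f = 0 from hf, map_zero]

end QuotSetup

end Setup

section GroupAction

variable {Γ A : Type*} [Group Γ] [Fintype Γ] [CommRing A]

lemma map_prod_orbit (T : Γ → A →+* A) (hT : ∀ g h f, T (g * h) f = T g (T h f)) (a : A) (γ : Γ) :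
    T γ (∏ g, T g a) = ∏ g, T g a := by
  rw [map_prod]
  exact Fintype.prod_equiv (Equiv.mulLeft γ) _ _ fun g => (hT γ g a).symm

lemma map_sum_C_mul_prod [DecidableEq Γ] (T : Γ → A →+* A)
    (hT : ∀ g h f, T (g * h) f = T g (T h f)) (a b : A) (γ : Γ) :
    (∑ g, Polynomial.C (T g a) * ∏ h ∈ Finset.univ.erase g,
      (Polynomial.X - Polynomial.C (T h b))).map (T γ) =
    ∑ g, Polynomial.C (T g a) * ∏ h ∈ Finset.univ.erase g,
      (Polynomial.X - Polynomial.C (T h b)) := by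
  simp only [Polynomial.map_sum, Polynomial.map_mul, Polynomial.map_C, Polynomial.map_prod,
    Polynomial.map_sub, Polynomial.map_X, ← hT]
  refine Fintype.sum_equiv (Equiv.mulLeft γ) _ _ fun g => ?_
  rw [Equiv.coe_mulLeft]
  congr 1
  refine Finset.prod_equiv (Equiv.mulLeft γ) (by simp) fun h _ => rfl

end GroupAction

section Descent

variable {m : ℕ} {Γ : Subgroup (Matrix.GeneralLinearGroup (Fin m) k)} [Finite Γ] [CharZero k]
  {I : Ideal (MvPolynomial (Fin m) k)}

lemma exists_forall_matAct_sub_notMem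
    (hin : ∀ g ∈ Γ, (∀ f, matAct g f - f ∈ I) → g = 1) :
    ∃ b, ∀ g ∈ Γ, matAct g b - b ∈ I → g = 1 := by
  by_contra! H
  let U : {g : Γ // (g : Matrix.GeneralLinearGroup (Fin m) k) ≠ 1} →
      Submodule k (MvPolynomial (Fin m) k) := fun g => (I.restrictScalars k).comap
    ((matAct (g : Matrix.GeneralLinearGroup (Fin m) k)).toLinearMap - LinearMap.id)
  have hU : ⋃ t, (U t : Set (MvPolynomial (Fin m) k)) = Set.univ := by
    refine Set.eq_univ_of_forall fun a => ?_
    obtain ⟨g, hg, hgI, hg1⟩ := H a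
    exact Set.mem_iUnion.mpr ⟨⟨⟨g, hg⟩, hg1⟩, hgI⟩
  obtain ⟨g, hg⟩ := Subspace.exists_eq_top_of_iUnion_eq_univ hU
  exact g.2 (hin g g.1.2 fun f => (hg ▸ Submodule.mem_top : f ∈ U g))

/-- Generic freeness of the action on the zero locus of a prime lets one descend its elements
to invariants after multiplying by an invariant outside of the prime. -/
lemma exists_mul_mem_span_invariants (hI : I.IsPrime) (hst : ∀ g ∈ Γ, ∀ f ∈ I, matAct g f ∈ I)
    (hin : ∀ g ∈ Γ, (∀ f, matAct g f - f ∈ I) → g = 1) {a : MvPolynomial (Fin m) k} (ha : a ∈ I) :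
    ∃ s ∈ invariants Γ, s ∉ I ∧
      s * a ∈ Ideal.span ((I : Set (MvPolynomial (Fin m) k)) ∩ invariants Γ) := by
  classical
  have := Fintype.ofFinite Γ
  obtain ⟨b, hb⟩ := exists_forall_matAct_sub_notMem hin
  let T : Γ → MvPolynomial (Fin m) k →ₐ[k] MvPolynomial (Fin m) k :=
    fun g => matAct (g : Matrix.GeneralLinearGroup (Fin m) k)
  have hT : ∀ g h f, T (g * h) f = T g (T h f) := fun g h f => matAct_mul _ _ _
  have hT1 : ∀ f, T 1 f = f := fun f => matAct_one _
  let L : Polynomial (MvPolynomial (Fin m) k) := ∑ g : Γ, Polynomial.C (T g a) *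
    ∏ h ∈ Finset.univ.erase g, (Polynomial.X - Polynomial.C (T h b))
  let Δ : MvPolynomial (Fin m) k := ∏ h ∈ Finset.univ.erase (1 : Γ), (b - T h b)
  have hΔ : Δ ∉ I := by
    intro hmem
    obtain ⟨h, hh, hhI⟩ := (hI.prod_mem_iff).mp hmem
    refine (Finset.mem_erase.mp hh).1 (Subtype.ext (hb h h.2 ?_))
    rw [← neg_sub]
    exact I.neg_mem hhI
  have hLI : ∀ i, L.coeff i ∈ I := fun i => by
    rw [Polynomial.finsetSum_coeff]
    refine sum_mem fun g _ => ?_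
    rw [Polynomial.coeff_C_mul]
    exact I.mul_mem_right _ (hst g g.2 a ha)
  have hLinv : ∀ i, L.coeff i ∈ invariants Γ := fun i γ hγ => by
    have : L.map (T ⟨γ, hγ⟩ : MvPolynomial (Fin m) k →+* MvPolynomial (Fin m) k) = L :=
      map_sum_C_mul_prod (fun g => (T g : MvPolynomial (Fin m) k →+* MvPolynomial (Fin m) k))
        hT a b ⟨γ, hγ⟩
    conv_rhs => rw [← this]
    rw [Polynomial.coeff_map]
    rfl
  have hLb : L.eval b = a * Δ := by
    simp only [L, Polynomial.eval_finsetSum, Polynomial.eval_mul, Polynomial.eval_C,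
      Polynomial.eval_prod, Polynomial.eval_sub, Polynomial.eval_X]
    rw [Finset.sum_eq_single 1]
    · rw [hT1]
    · intro g _ hg
      rw [Finset.prod_eq_zero (i := 1) (by simp [Ne.symm hg]) (by rw [hT1, sub_self]), mul_zero]
    · simp
  have hmem : a * Δ ∈ Ideal.span ((I : Set (MvPolynomial (Fin m) k)) ∩ invariants Γ) := by
    rw [← hLb, Polynomial.eval_eq_sum, Polynomial.sum]
    exact sum_mem fun i _ => Ideal.mul_mem_right _ _ (Ideal.subset_span ⟨hLI i, hLinv i⟩)
  refine ⟨∏ g : Γ, T g Δ, ?_, ?_, ?_⟩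
  · intro γ hγ
    change T ⟨γ, hγ⟩ _ = _
    exact map_prod_orbit (fun g => (T g : MvPolynomial (Fin m) k →+* MvPolynomial (Fin m) k))
      hT Δ ⟨γ, hγ⟩
  · intro h
    obtain ⟨g, -, hg⟩ := (hI.prod_mem_iff).mp h
    refine hΔ ?_
    have := hst _ (g⁻¹).2 _ hg
    change T g⁻¹ (T g Δ) ∈ I at this
    rwa [← hT, inv_mul_cancel, hT1] at this
  · rw [← Finset.mul_prod_erase _ _ (Finset.mem_univ (1 : Γ)), hT1, mul_right_comm, mul_comm Δ]
    exact Ideal.mul_mem_right _ _ hmem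

/-- A stable prime with trivial inertia is generated by invariants. -/
lemma le_span_inter_invariants (hΓ : IsReflectionGroup Γ) (hI : I.IsPrime)
    (hst : ∀ g ∈ Γ, ∀ f ∈ I, matAct g f ∈ I)
    (hin : ∀ g ∈ Γ, (∀ f, matAct g f - f ∈ I) → g = 1) :
    I ≤ Ideal.span ((I : Set (MvPolynomial (Fin m) k)) ∩ invariants Γ) := by
  intro a ha
  obtain ⟨s, hs, hsI, hsa⟩ := exists_mul_mem_span_invariants hI hst hin ha
  obtain ⟨N, x, j, hxj⟩ := Submodule.mem_span_set'.mp hsa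
  let α : Option (Fin N) → MvPolynomial (Fin m) k := fun i => i.elim s fun i => -(j i : _)
  let g : Option (Fin N) → MvPolynomial (Fin m) k := fun i => i.elim a x
  have hα : ∀ i, α i ∈ invariants Γ := by
    rintro (_ | i)
    · exact hs
    · exact neg_mem (j i).2.2
  have hsum : ∑ i, α i * g i = 0 := by
    rw [Fintype.sum_option]
    simp only [α, g, Option.elim_none, Option.elim_some, neg_mul, Finset.sum_neg_distrib]
    rw [← hxj, ← sub_eq_add_neg, ← Finset.sum_sub_distrib]
    exact Finset.sum_eq_zero fun i _ => by rw [smul_eq_mul, mul_comm, sub_self]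
  set K := Ideal.span ((I : Set (MvPolynomial (Fin m) k)) ∩ invariants Γ) with hK
  have hle : Submodule.span (MvPolynomial (Fin m) k)
      (invRelations Γ α : Set (Option (Fin N) → MvPolynomial (Fin m) k)) ≤
      Submodule.comap (LinearMap.proj none) K := by
    refine Submodule.span_le.mpr fun y hy => ?_
    obtain ⟨h1, h2⟩ := (mem_invRelations Γ).mp hy
    refine Ideal.subset_span ⟨?_, h1 none⟩
    rw [Fintype.sum_option] at h2
    refine (hI.mem_or_mem (x := s) ?_).resolve_left hsI
    have h3 : s * y none = -∑ i, α (some i) * y (some i) := eq_neg_of_add_eq_zero_left h2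
    change s * y none ∈ I
    rw [h3]
    exact I.neg_mem (sum_mem fun i _ => I.mul_mem_right _ (I.neg_mem (j i).2.1))
  exact hle (mem_span_invRelations hΓ hα hsum)

end Descent

lemma card_compl_range_add_card {ι κ : Type} [Finite ι] {a : κ → ι} (ha : Function.Injective a) :
    Nat.card {i // i ∉ Set.range a} + Nat.card κ = Nat.card ι := by
  classical
  have : Finite κ := Finite.of_injective a ha
  rw [Nat.card_congr (Equiv.ofInjective a ha), add_comm, ← Nat.card_sum]
  exact Nat.card_congr (Equiv.Set.sumCompl (Set.range a))

lemma exists_sub_aeval_mem {n : ℕ} {ι κ : Type} {f : ι → MvPolynomial (Fin n) k}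
    {g : κ → MvPolynomial (Fin n) k} {K : Ideal (MvPolynomial (Fin n) k)}
    (h : ∀ i, ∃ Q : MvPolynomial κ k, f i - aeval g Q ∈ K)
    {x : MvPolynomial (Fin n) k} (hx : x ∈ Algebra.adjoin k (Set.range f)) :
    ∃ Q : MvPolynomial κ k, x - aeval g Q ∈ K := by
  let R := ((Ideal.Quotient.mkₐ k K).comp (aeval g)).range.comap (Ideal.Quotient.mkₐ k K)
  have hR : ∀ y, y ∈ R ↔ ∃ Q : MvPolynomial κ k, y - aeval g Q ∈ K := fun y => by
    change (∃ Q : MvPolynomial κ k, Ideal.Quotient.mk K (aeval g Q) = Ideal.Quotient.mk K y) ↔ _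
    refine exists_congr fun Q => ?_
    rw [eq_comm, Ideal.Quotient.eq]
  rw [← hR]
  refine Algebra.adjoin_le ?_ hx
  rintro _ ⟨i, rfl⟩
  exact (hR _).mpr (h i)

lemma exists_finset_span_eq {A : Type} [CommRing A] [IsDomain A] [Infinite A] {I : Ideal A}
    (hI : I ≠ ⊥) {N : ℕ} {κ : Type} [Finite κ] {r : κ → A} (hr : Ideal.span (Set.range r) = I)
    (hκ : Nat.card κ ≤ N) : ∃ s : Finset A, s.card = N ∧ Ideal.span (s : Set A) = I := by
  obtain ⟨x, hx, hx0⟩ := Submodule.exists_mem_ne_zero_of_ne_bot hI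
  have hinf : (I : Set A).Infinite :=
    (Set.infinite_range_of_injective (mul_left_injective₀ hx0)).mono
      (by rintro _ ⟨y, rfl⟩; exact I.mul_mem_left y hx)
  have hsub : Set.range r ⊆ (I : Set A) := hr ▸ Ideal.subset_span
  have hcard : (Set.range r).ncard ≤ N := (Finite.card_range_le r).trans hκ
  have hN : N ≠ 0 := by
    rintro rfl
    have := (Finite.card_eq_zero_iff).mp (Nat.le_zero.mp hκ)
    rw [Set.range_eq_empty, Ideal.span_empty] at hr
    exact hI hr.symm
  obtain ⟨t, hrt, htI, hcardt⟩ := hinf.exists_superset_ncard_eq hsub (Set.finite_range r) hcard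
  have ht : t.Finite := Set.finite_of_ncard_ne_zero (hcardt ▸ hN)
  refine ⟨ht.toFinset, ?_, ?_⟩
  · rw [← hcardt, Set.ncard_eq_toFinset_card t ht]
  · rw [Set.Finite.coe_toFinset]
    exact le_antisymm (Ideal.span_le.mpr htI) (hr ▸ Ideal.span_mono hrt)

section Forward

variable [CharZero k] {n m : ℕ} {Wt G : Subgroup (Matrix.GeneralLinearGroup (Fin n) k)}
  {p : Fin m → MvPolynomial (Fin n) k} {d : Fin m → ℕ} {c : ↥Wt → Fin m → Fin m → k}

namespace QuotSetup

lemma relIdeal_le_span (hs : QuotSetup Wt G p d c) (hΓ : IsReflectionGroup hs.rep.range) :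
    relIdeal p ≤ Ideal.span
      ((relIdeal p : Set (MvPolynomial (Fin m) k)) ∩ invariants hs.rep.range) := by
  have := hs.finite_range
  exact le_span_inter_invariants hΓ (RingHom.ker_isPrime _)
    (fun g hg f hf => hs.map_relIdeal_le hg hf) fun g hg h => hs.eq_one_of_forall_sub_mem hg h

lemma trivialConormal (hs : QuotSetup Wt G p d c) (hΓ : IsReflectionGroup hs.rep.range) :
    TrivialConormal Wt p c := by
  intro w f hf
  rw [hs.polyAct_eq]
  have hw : hs.rep w ∈ hs.rep.range := ⟨w, rfl⟩
  induction hs.relIdeal_le_span hΓ hf using Submodule.span_induction with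
  | mem x hx =>
    rw [hx.2 _ hw, sub_self]
    exact zero_mem _
  | zero =>
    rw [map_zero, sub_self]
    exact zero_mem _
  | add x y hx hy ihx ihy =>
    have hle := Ideal.span_le.mpr (Set.inter_subset_left
      (s := (relIdeal p : Set (MvPolynomial (Fin m) k))) (t := invariants hs.rep.range))
    rw [map_add, add_sub_add_comm]
    exact add_mem (ihx (hle hx)) (ihy (hle hy))
  | smul a x hx ih =>
    have hle := Ideal.span_le.mpr (Set.inter_subset_left
      (s := (relIdeal p : Set (MvPolynomial (Fin m) k))) (t := invariants hs.rep.range))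
    have h1 : matAct (hs.rep w) (a • x) - a • x =
        (matAct (hs.rep w) a - a) * matAct (hs.rep w) x + a * (matAct (hs.rep w) x - x) := by
      rw [smul_eq_mul, map_mul]
      ring
    rw [h1]
    refine add_mem (Ideal.mul_mem_mul ?_ (hs.map_relIdeal_le hw (hle hx)))
      (Ideal.mul_mem_left _ _ (ih (hle hx)))
    rw [mem_idealPlus_iff, map_sub, constantCoeff_matAct, sub_self]

lemma exists_generators (hs : QuotSetup Wt G p d c) (hΓ : IsReflectionGroup hs.rep.range) :
    ∃ (κ : Type) (_ : Finite κ) (r : κ → MvPolynomial (Fin m) k),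
      Nat.card κ ≤ m - n ∧ Ideal.span (Set.range r) = relIdeal p := by
  have := hs.finite_range
  have : Finite Wt := hs.finite
  obtain ⟨ι, f, hf, hfspan, hfind⟩ := exists_homogeneous_basis hs.preservesWeights hs.dpos
  obtain ⟨_, hιm⟩ := card_le_of_linearIndependent hΓ hf hfind
  have hF : ∀ i, aeval p (f i) ∈ homogInvariants Wt 1 := fun i => by
    obtain ⟨h1, e, he, hfe⟩ := hf i
    exact ⟨hs.aeval_mem_invariants h1, e, he, isWeightedHomogeneous_aeval hs.homog hfe⟩
  have hFspan : posInvariants Wt ≤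
      Submodule.span k (Set.range fun i => aeval p (f i)) ⊔ sqSpan Wt := by
    have h1 := Submodule.map_mono (f := (aeval p).toLinearMap) hfspan
    rw [hs.map_posInvariants, Submodule.map_sup, hs.map_sqSpan, Submodule.map_span,
      ← Set.range_comp] at h1
    exact h1
  obtain ⟨κ, a, ha, hgspan, hgind⟩ := exists_subfamily hFspan
  have : Finite κ := Finite.of_injective a ha
  have := Fintype.ofFinite κ
  have hg : ∀ j, aeval p (f (a j)) ∈ homogInvariants Wt 1 := fun j => hF (a j)
  have hadj := adjoin_eq_invariants (preservesWeights_one Wt) (fun _ => one_pos) hg hgspan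
  have hgalg := algebraicIndependent_of_linearIndependent hs.reflGroup hg hgind
  have hn := le_card_of_adjoin_eq_invariants hadj
  have hQ : ∀ i, ∃ Q : MvPolynomial κ k,
      aeval (fun j => aeval p (f (a j))) Q = aeval p (f i) := fun i => by
    have h1 := (hF i).1
    rw [← hadj, Algebra.adjoin_range_eq_range_aeval] at h1
    exact h1
  choose Q hQ using hQ
  have hcomp : ∀ P : MvPolynomial κ k,
      aeval p (aeval (f ∘ a) P) = aeval (fun j => aeval p (f (a j))) P := fun P => by
    rw [← AlgHom.comp_apply, comp_aeval]
    rfl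
  let r : {i // i ∉ Set.range a} → MvPolynomial (Fin m) k := fun i => f i - aeval (f ∘ a) (Q i)
  have hr : ∀ i, r i ∈ relIdeal p := fun i => by
    change aeval p _ = 0
    rw [map_sub, hcomp, hQ, sub_self]
  refine ⟨_, inferInstance, r, ?_, le_antisymm (Ideal.span_le.mpr ?_) ?_⟩
  · have h1 := card_compl_range_add_card ha
    rw [← Nat.card_eq_fintype_card] at hn
    omega
  · rintro _ ⟨i, rfl⟩
    exact hr i
  · refine (hs.relIdeal_le_span hΓ).trans (Ideal.span_le.mpr ?_)
    rintro x ⟨hxI, hxS⟩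
    have hK : Ideal.span (Set.range r) ≤ relIdeal p :=
      Ideal.span_le.mpr (by rintro _ ⟨i, rfl⟩; exact hr i)
    rw [← adjoin_eq_invariants hs.preservesWeights hs.dpos hf hfspan] at hxS
    obtain ⟨P, hP⟩ := exists_sub_aeval_mem (g := f ∘ a) (K := Ideal.span (Set.range r))
      (fun i => by
        by_cases hi : i ∈ Set.range a
        · obtain ⟨j, rfl⟩ := hi
          refine ⟨X j, ?_⟩
          rw [aeval_X, Function.comp_apply, sub_self]
          exact zero_mem _
        · exact ⟨Q i, Ideal.subset_span ⟨⟨i, hi⟩, rfl⟩⟩) hxS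
    have h2 : aeval p (x - aeval (f ∘ a) P) = 0 := hK hP
    rw [map_sub, show aeval p x = 0 from hxI, zero_sub, neg_eq_zero, hcomp] at h2
    have h3 : P = 0 := hgalg (h2.trans (map_zero _).symm)
    rw [h3, map_zero, sub_zero] at hP
    exact hP

lemma isCompleteIntersection (hs : QuotSetup Wt G p d c) (hΓ : IsReflectionGroup hs.rep.range) :
    IsCompleteIntersection p := by
  obtain ⟨κ, _, r, hκ, hr⟩ := hs.exists_generators hΓ
  by_cases hI : relIdeal p = ⊥
  · have h1 : AlgebraicIndependent k p := (RingHom.injective_iff_ker_eq_bot _).mpr hI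
    have h2 := (card_le_of_algebraicIndependent h1).1
    rw [Nat.card_fin] at h2
    exact ⟨∅, by rw [Finset.card_empty, Nat.sub_eq_zero_of_le h2], by
      rw [hI, Finset.coe_empty, Ideal.span_empty]⟩
  · have : Infinite (MvPolynomial (Fin m) k) :=
      Infinite.of_injective (fun a : ℕ => (a : MvPolynomial (Fin m) k)) Nat.cast_injective
    exact exists_finset_span_eq hI hr hκ

end QuotSetup

end Forward

lemma sqSpan_le_posInvariants {n : ℕ} (Γ : Subgroup (Matrix.GeneralLinearGroup (Fin n) k)) :
    sqSpan Γ ≤ posInvariants Γ := by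
  refine Submodule.span_le.mpr ?_
  rintro _ ⟨u, hu, v, hv, hu0, -, rfl⟩
  exact ⟨mul_mem hu hv, by rw [map_mul, hu0, zero_mul]⟩

lemma le_comap_pow_mul {A : Type} [CommRing A] {f : A →+* A} {I J : Ideal A}
    (hI : ∀ x ∈ I, f x ∈ I) (hJ : ∀ x ∈ J, f x ∈ J) (N : ℕ) : I ^ N * J ≤ (I ^ N * J).comap f :=
  (Ideal.mul_mono ((Ideal.pow_right_mono hI N).trans (Ideal.le_comap_pow f N)) hJ).trans
    (Ideal.le_comap_mul f)

section Backward

variable [CharZero k] {n m : ℕ} {Wt G : Subgroup (Matrix.GeneralLinearGroup (Fin n) k)}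
  {p : Fin m → MvPolynomial (Fin n) k} {d : Fin m → ℕ} {c : ↥Wt → Fin m → Fin m → k}

namespace QuotSetup

lemma reynolds_mem_pow_mul (hs : QuotSetup Wt G p d c) [Fintype hs.rep.range] (N : ℕ)
    {f : MvPolynomial (Fin m) k} (hf : f ∈ idealPlus k m ^ N * relIdeal p) :
    reynolds hs.rep.range f ∈ idealPlus k m ^ N * relIdeal p := by
  have h1 : f - reynolds hs.rep.range f ∈
      (idealPlus k m ^ N * relIdeal p).restrictScalars k := sub_reynolds_mem _ fun g hg => by
    refine sub_mem ?_ hf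
    have h2 : ∀ x ∈ idealPlus k m, (matAct g).toRingHom x ∈ idealPlus k m := fun x hx => by
      change matAct g x ∈ idealPlus k m
      rw [mem_idealPlus_iff, constantCoeff_matAct]
      exact mem_idealPlus_iff.mp hx
    have h3 : ∀ x ∈ relIdeal p, (matAct g).toRingHom x ∈ relIdeal p := fun x hx =>
      hs.map_relIdeal_le hg hx
    exact le_comap_pow_mul h2 h3 N hf
  rw [← sub_sub_cancel f (reynolds hs.rep.range f)]
  exact sub_mem hf h1

lemma reynolds_mem_posInvariants (hs : QuotSetup Wt G p d c) [Fintype hs.rep.range]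
    {f : MvPolynomial (Fin m) k} (hf : constantCoeff f = 0) :
    reynolds hs.rep.range f ∈ posInvariants hs.rep.range :=
  ⟨reynolds_mem _ f, by rw [constantCoeff_reynolds, hf]⟩

lemma reynolds_mem_sqSpan_sup (hs : QuotSetup Wt G p d c) (ht : TrivialConormal Wt p c)
    [Fintype hs.rep.range] (N : ℕ) {y : MvPolynomial (Fin m) k}
    (hy : y ∈ idealPlus k m ^ (N + 1) * relIdeal p) :
    reynolds hs.rep.range y ∈ sqSpan hs.rep.range ⊔
      (idealPlus k m ^ (N + 2) * relIdeal p).restrictScalars k := by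
  induction hy using Submodule.mul_induction_on' with
  | mem_mul_mem a ha u hu =>
    have ha0 : constantCoeff a = 0 :=
      mem_idealPlus_iff.mp (Ideal.pow_le_self (Nat.succ_ne_zero N) ha)
    have hu1 : u - reynolds hs.rep.range u ∈
        (idealPlus k m * relIdeal p).restrictScalars k := sub_reynolds_mem _ (by
      rintro _ ⟨w, rfl⟩
      rw [← hs.polyAct_eq]
      exact ht w u hu)
    have h1 : a * u = a * reynolds hs.rep.range u + a * (u - reynolds hs.rep.range u) := by ring
    rw [h1, map_add, reynolds_mul_right _ _ (reynolds_mem _ u)]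
    refine Submodule.add_mem_sup (mul_mem_sqSpan (hs.reynolds_mem_posInvariants ha0)
      (hs.reynolds_mem_posInvariants (hs.constantCoeff_eq_zero_of_mem hu))) ?_
    refine hs.reynolds_mem_pow_mul (N + 2) ?_
    rw [pow_succ, mul_assoc]
    exact Ideal.mul_mem_mul ha hu1
  | add x _ y _ hx hy =>
    rw [map_add]
    exact add_mem hx hy

lemma mem_sqSpan_of_mem_mul (hs : QuotSetup Wt G p d c) (ht : TrivialConormal Wt p c)
    {x : MvPolynomial (Fin m) k} (hx : x ∈ idealPlus k m * relIdeal p)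
    (hxS : x ∈ invariants hs.rep.range) : x ∈ sqSpan hs.rep.range := by
  have := hs.finite_range
  have := Fintype.ofFinite hs.rep.range
  have key : ∀ N, ∃ z ∈ sqSpan hs.rep.range, x - z ∈ idealPlus k m ^ (N + 1) * relIdeal p := by
    intro N
    induction N with
    | zero => exact ⟨0, zero_mem _, by rwa [sub_zero, zero_add, pow_one]⟩
    | succ N ih =>
      obtain ⟨z, hz, hxz⟩ := ih
      have hinv : x - z ∈ invariants hs.rep.range :=
        sub_mem hxS (sqSpan_le_posInvariants _ hz).1
      have h1 := hs.reynolds_mem_sqSpan_sup ht N hxz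
      rw [reynolds_eq_self _ hinv] at h1
      obtain ⟨z', hz', u, hu, hsum⟩ := Submodule.mem_sup.mp h1
      refine ⟨z + z', add_mem hz hz', ?_⟩
      have h2 : x - (z + z') = u := by
        rw [← sub_sub, ← hsum, add_sub_cancel_left]
      rw [h2]
      exact hu
  refine mem_sqSpan_of_sub_mem_pow fun N => ?_
  obtain ⟨z, hz, hxz⟩ := key N
  exact ⟨z, hz, Ideal.pow_le_pow_right N.le_succ (Ideal.mul_le_left hxz)⟩

lemma reynolds_mem_span_sup (hs : QuotSetup Wt G p d c) (ht : TrivialConormal Wt p c)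
    [Fintype hs.rep.range] {s : Set (MvPolynomial (Fin m) k)} (hsI : Ideal.span s = relIdeal p)
    {x : MvPolynomial (Fin m) k} (hx : x ∈ relIdeal p) :
    reynolds hs.rep.range x ∈
      Submodule.span k (reynolds hs.rep.range '' s) ⊔ sqSpan hs.rep.range := by
  rw [← hsI] at hx
  induction hx using Submodule.span_induction with
  | mem y hy => exact Submodule.mem_sup_left (Submodule.subset_span ⟨y, hy, rfl⟩)
  | zero =>
    rw [map_zero]
    exact zero_mem _
  | add y z _ _ hy hz =>
    rw [map_add]
    exact add_mem hy hz
  | smul a y hy ih =>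
    have hyI : y ∈ relIdeal p := hsI ▸ hy
    have h1 : a • y = constantCoeff a • y + (a - C (constantCoeff a)) * y := by
      rw [smul_eq_C_mul, smul_eq_mul]
      ring
    rw [h1, map_add, map_smul]
    refine add_mem (Submodule.smul_mem _ _ ih) (Submodule.mem_sup_right
      (hs.mem_sqSpan_of_mem_mul ht ?_ (reynolds_mem _ _)))
    have h2 := hs.reynolds_mem_pow_mul 1 (f := (a - C (constantCoeff a)) * y)
    rw [pow_one] at h2
    refine h2 (Ideal.mul_mem_mul ?_ hyI)
    rw [mem_idealPlus_iff, map_sub, constantCoeff_C, sub_self]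

lemma exists_finite_spanning (hs : QuotSetup Wt G p d c) (hci : IsCompleteIntersection p)
    (ht : TrivialConormal Wt p c) :
    ∃ v : Set (MvPolynomial (Fin m) k), v.Finite ∧ v.ncard ≤ m ∧
      posInvariants hs.rep.range ≤ Submodule.span k v ⊔ sqSpan hs.rep.range := by
  have := hs.finite_range
  have := Fintype.ofFinite hs.rep.range
  have : Finite Wt := hs.finite
  have := hs.finite_subgroup
  have hnm := le_card_of_adjoin_eq_invariants hs.gen
  rw [Fintype.card_fin] at hnm
  obtain ⟨s, hscard, hsI⟩ := hci
  obtain ⟨ι, g, hg, hgspan, hgind⟩ :=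
    exists_homogeneous_basis (preservesWeights_one Wt) (fun _ => one_pos)
  obtain ⟨_, hιn⟩ := card_le_of_linearIndependent hs.reflGroup hg hgind
  have hlift : ∀ i, ∃ f ∈ posInvariants hs.rep.range, aeval p f = g i := fun i => by
    have h1 := homogInvariants_subset (hg i)
    rw [← hs.map_posInvariants] at h1
    exact h1
  choose F hF hFg using hlift
  refine ⟨reynolds hs.rep.range '' s ∪ Set.range F,
    (s.finite_toSet.image _).union (Set.finite_range F), ?_, fun x hx => ?_⟩
  · refine (Set.ncard_union_le _ _).trans ?_
    have h1 : (reynolds hs.rep.range '' (s : Set (MvPolynomial (Fin m) k))).ncard ≤ m - n := by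
      rw [← hscard, ← Set.ncard_coe_finset s]
      exact Set.ncard_image_le s.finite_toSet
    have h2 : (Set.range F).ncard ≤ n := (Finite.card_range_le F).trans hιn
    omega
  · have h1 : aeval p x ∈ (Submodule.span k (Set.range F) ⊔ sqSpan hs.rep.range).map
        (aeval p).toLinearMap := by
      rw [Submodule.map_sup, hs.map_sqSpan, Submodule.map_span, ← Set.range_comp]
      have h2 : (aeval p).toLinearMap ∘ F = g := funext hFg
      rw [h2]
      exact hgspan (hs.map_posInvariants ▸ ⟨x, hx, rfl⟩)
    obtain ⟨y, hy, hyx⟩ := h1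
    have hle : Submodule.span k (Set.range F) ⊔ sqSpan hs.rep.range ≤
        posInvariants hs.rep.range :=
      sup_le (Submodule.span_le.mpr (by rintro _ ⟨i, rfl⟩; exact hF i))
        (sqSpan_le_posInvariants _)
    have hyS := hle hy
    have hxy : x - y ∈ relIdeal p := by
      change aeval p _ = 0
      rw [map_sub]
      exact sub_eq_zero.mpr hyx.symm
    have h3 := hs.reynolds_mem_span_sup ht hsI hxy
    rw [reynolds_eq_self _ (sub_mem hx.1 hyS.1)] at h3
    rw [← sub_add_cancel x y]
    have h4 : ∀ {w : Set (MvPolynomial (Fin m) k)},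
        w ⊆ reynolds hs.rep.range '' s ∪ Set.range F →
        Submodule.span k w ⊔ sqSpan hs.rep.range ≤
          Submodule.span k (reynolds hs.rep.range '' s ∪ Set.range F) ⊔ sqSpan hs.rep.range :=
      fun hw => sup_le_sup_right (Submodule.span_mono hw) _
    exact add_mem (h4 Set.subset_union_left h3) (h4 Set.subset_union_right hy)

lemma isReflectionGroup_range (hs : QuotSetup Wt G p d c) (hci : IsCompleteIntersection p)
    (ht : TrivialConormal Wt p c) : IsReflectionGroup hs.rep.range := by
  have := hs.finite_range
  obtain ⟨v, hv, hvcard, hvspan⟩ := hs.exists_finite_spanning hci ht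
  obtain ⟨ι, f, hf, hfspan, hfind⟩ :=
    exists_homogeneous_basis (preservesWeights_one hs.rep.range) (fun _ => one_pos)
  have hle : Cardinal.mk ι ≤ Cardinal.mk (Fin m) := by
    have hw := hv.image (sqSpan hs.rep.range).mkQ
    have := hw.fintype
    have h1 := linearIndependent_le_span' _ hfind ((sqSpan hs.rep.range).mkQ '' v) (by
      rintro _ ⟨i, rfl⟩
      have h2 := Submodule.mem_map_of_mem (f := (sqSpan hs.rep.range).mkQ)
        (hvspan (homogInvariants_subset (hf i)))
      rw [Submodule.map_sup, Submodule.mkQ_map_self, sup_bot_eq, Submodule.map_span] at h2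
      exact h2)
    refine h1.trans ?_
    rw [Cardinal.mk_fin, Nat.cast_le, ← Nat.card_eq_fintype_card]
    exact (Set.ncard_image_le hv).trans hvcard
  obtain ⟨e⟩ := hle
  have hadj := adjoin_eq_invariants (preservesWeights_one hs.rep.range) (fun _ => one_pos) hf hfspan
  rw [← adjoin_range_extend e f] at hadj
  have hext : ∀ i, Function.extend e f (0 : Fin m → MvPolynomial (Fin m) k) i = 0 ∨
      ∃ j, Function.extend e f (0 : Fin m → MvPolynomial (Fin m) k) i = f j := fun i => by
    by_cases hi : ∃ j, e j = i
    · obtain ⟨j, rfl⟩ := hi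
      exact Or.inr ⟨j, e.injective.extend_apply f _ j⟩
    · exact Or.inl (Function.extend_apply' f _ i hi)
  have hhom : ∀ i, ∃ N, (Function.extend e f
      (0 : Fin m → MvPolynomial (Fin m) k) i).IsHomogeneous N := fun i => by
    obtain h | ⟨j, h⟩ := hext i <;> rw [h]
    · exact ⟨0, isHomogeneous_zero _ _ _⟩
    · obtain ⟨-, N, -, hN⟩ := hf j
      exact ⟨N, hN⟩
  choose D hD using hhom
  refine isReflectionGroup_of_adjoin hD (fun i => ?_) hadj
  obtain h | ⟨j, h⟩ := hext i <;> rw [h]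
  · exact map_zero _
  · exact (homogInvariants_subset (hf j)).2

end QuotSetup

end Backward

/-- the induced homomorphism `W = Wt/G → GL(V)` is injective with image
a reflection group on `V` if and only if `G` is of complete intersection and `W` acts
trivially on `I/(A_+ I)`, i.e. iff `G` is a good normal subgroup of `Wt`. -/
theorem statement1 [CharZero k] {n m : ℕ}
    (Wt G : Subgroup (Matrix.GeneralLinearGroup (Fin n) k))
    (p : Fin m → MvPolynomial (Fin n) k) (d : Fin m → ℕ)
    (c : ↥Wt → Fin m → Fin m → k)
    (hsetup : QuotSetup Wt G p d c) :
    (∃ ρ : ↥Wt →* Matrix.GeneralLinearGroup (Fin m) k,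
        (∀ (w : ↥Wt) (i j : Fin m),
          ((ρ w : Matrix.GeneralLinearGroup (Fin m) k) : Matrix (Fin m) (Fin m) k) i j
            = qMat c w i j) ∧
        MonoidHom.ker ρ = G.subgroupOf Wt ∧
        IsReflectionGroup (MonoidHom.range ρ))
      ↔ (IsCompleteIntersection p ∧ TrivialConormal Wt p c) := by
  constructor
  · rintro ⟨ρ, hρ, -, hrefl⟩
    obtain rfl : ρ = hsetup.rep := MonoidHom.ext fun w => Units.ext (Matrix.ext fun i j => hρ w i j)
    exact ⟨hsetup.isCompleteIntersection hrefl, hsetup.trivialConormal hrefl⟩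
  · rintro ⟨hci, ht⟩
    exact ⟨hsetup.rep, fun w i j => rfl, hsetup.ker_rep, hsetup.isReflectionGroup_range hci ht⟩

end ReflQuot
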